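/- Let Ω ⊆ ℝ^n be open, (φ_ε)_{ε∈(0,1]} ∈ M_Φ(Ω×ℝ^p), and define, with φ_{φ_ε}(y,ξ) := |∇_{y,ξ}φ_ε(y,ξ/|ξ|)|^{−2} and a cutoff χ ∈ C_c^∞(ℝ^p) with χ(ξ)=1 for |ξ|<1/4 and χ(ξ)=0 for |ξ|>1/2: a_{j,ε} := i(1−χ(ξ)) φ_{φ_ε} ∂_{ξ_j}φ_ε (j=1,…,p), b_{k,ε} := i(1−χ(ξ)) |ξ|^{−2} φ_{φ_ε} ∂_{y_k}φ_ε (k=1,…,n), and c_ε := χ + Σ_{j=1}^p ∂_{ξ_j} a_{j,ε} + Σ_{k=1}^n ∂_{y_k} b_{k,ε}. Then each a_{j,ε}, b_{k,ε}, c_ε extends to a smooth function on all of Ω×ℝ^p, the net (a_{j,ε})_ε is a moderate net in S^0(Ω×ℝ^p) for each j, and the nets (b_{k,ε})_ε and (c_ε)_ε are moderate nets in S^{−1}(Ω×ℝ^p). -/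

import Mathlib

open MeasureTheory Set
open scoped BigOperators Topology Real

noncomputable section

/-- `Euc d` is `d`-dimensional Euclidean space. -/
abbrev Euc (d : ℕ) : Type := EuclideanSpace ℝ (Fin d)

/-- Directional derivative of `f` in direction `v`. -/
def dirD {E F : Type*} [NormedAddCommGroup E] [NormedSpace ℝ E]
    [NormedAddCommGroup F] [NormedSpace ℝ F] (v : E) (f : E → F) : E → F :=
  fun x => fderiv ℝ f x v

/-- Iterated directional derivatives along a list of directions. -/
def dirDs {E F : Type*} [NormedAddCommGroup E] [NormedSpace ℝ E]
    [NormedAddCommGroup F] [NormedSpace ℝ F] (L : List E) (f : E → F) : E → F :=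
  L.foldr dirD f

/-- ⟨ξ⟩ = (1+|ξ|²)^{1/2}. -/
def jb {d : ℕ} (ξ : Euc d) : ℝ := Real.sqrt (1 + ‖ξ‖ ^ 2)

/-- Basis direction in the first (`y`) block. -/
def eY {n p : ℕ} (k : Fin n) : Euc n × Euc p := (EuclideanSpace.single k 1, 0)

/-- Basis direction in the second (`ξ`) block. -/
def eXi {n p : ℕ} (j : Fin p) : Euc n × Euc p := (0, EuclideanSpace.single j 1)

def eX3 {q n p : ℕ} (i : Fin q) : Euc q × Euc n × Euc p := (EuclideanSpace.single i 1, 0, 0)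
def eY3 {q n p : ℕ} (k : Fin n) : Euc q × Euc n × Euc p := (0, EuclideanSpace.single k 1, 0)
def eXi3 {q n p : ℕ} (j : Fin p) : Euc q × Euc n × Euc p := (0, 0, EuclideanSpace.single j 1)

/-- basis directions of `Euc d` indexed by a list of coordinates -/
def basisL {d : ℕ} (L : List (Fin d)) : List (Euc d) :=
  L.map (fun i => EuclideanSpace.single i 1)

/-- |∇_{y,ξ}φ|² as a sum of squares of partial derivatives. -/
def gradSq {n p : ℕ} (φ : Euc n × Euc p → ℝ) (z : Euc n × Euc p) : ℝ :=
  (∑ k : Fin n, (dirD (eY k) φ z) ^ 2) + ∑ j : Fin p, (dirD (eXi j) φ z) ^ 2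

/-- |∇_ξ φ|². -/
def gradXiSq {n p : ℕ} (φ : Euc n × Euc p → ℝ) (z : Euc n × Euc p) : ℝ :=
  ∑ j : Fin p, (dirD (eXi j) φ z) ^ 2

/-- ∇_y φ as a vector in `Euc n`. -/
def gradY {n p : ℕ} (φ : Euc n × Euc p → ℝ) (z : Euc n × Euc p) : Euc n :=
  (EuclideanSpace.equiv (Fin n) ℝ).symm (fun k => dirD (eY k) φ z)

/-- |∇_{y,ξ}φ|² in the three-block setting (gradient w.r.t. `(y,ξ)` only). -/
def gradSq3 {q n p : ℕ} (φ : Euc q × Euc n × Euc p → ℝ) (z : Euc q × Euc n × Euc p) : ℝ :=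
  (∑ k : Fin n, (dirD (eY3 k) φ z) ^ 2) + ∑ j : Fin p, (dirD (eXi3 j) φ z) ^ 2

/-- slow scale net -/
def SlowScale (s : ℝ → ℝ) : Prop :=
  (∀ ε ∈ Set.Ioc (0:ℝ) 1, 0 < s ε) ∧
  ∀ q : ℕ, ∃ c > 0, ∀ ε ∈ Set.Ioc (0:ℝ) 1, s ε ^ q ≤ c / ε

/-- Moderate net in S^m_{ρ,δ}(Ω×ℝ^p): smoothness, membership, moderate bounds. -/
def SymbModerate {n p : ℕ} (Ω : Set (Euc n)) (m ρ δ : ℝ)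
    (a : ℝ → Euc n × Euc p → ℂ) : Prop :=
  (∀ ε ∈ Set.Ioc (0:ℝ) 1, ContDiffOn ℝ (⊤ : ℕ∞) (a ε) (Ω ×ˢ (univ : Set (Euc p)))) ∧
  (∀ ε ∈ Set.Ioc (0:ℝ) 1, ∀ K ⊆ Ω, IsCompact K → ∀ (α : List (Fin p)) (β : List (Fin n)),
    ∃ C : ℝ, ∀ y ∈ K, ∀ ξ : Euc p,
      jb ξ ^ (-m + ρ * (α.length : ℝ) - δ * (β.length : ℝ)) *
        ‖dirDs (α.map eXi ++ β.map eY) (a ε) (y, ξ)‖ ≤ C) ∧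
  ∀ K ⊆ Ω, IsCompact K → ∀ (α : List (Fin p)) (β : List (Fin n)),
    ∃ N : ℕ, ∃ C > 0, ∃ η ∈ Set.Ioc (0:ℝ) 1, ∀ ε ∈ Set.Ioc (0:ℝ) η, ∀ y ∈ K, ∀ ξ : Euc p,
      jb ξ ^ (-m + ρ * (α.length : ℝ) - δ * (β.length : ℝ)) *
        ‖dirDs (α.map eXi ++ β.map eY) (a ε) (y, ξ)‖ ≤ C * ε ^ (-(N : ℤ))

/-- Negligible net in S^m_{ρ,δ}(Ω×ℝ^p). -/
def SymbNegligible {n p : ℕ} (Ω : Set (Euc n)) (m ρ δ : ℝ)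
    (a : ℝ → Euc n × Euc p → ℂ) : Prop :=
  (∀ ε ∈ Set.Ioc (0:ℝ) 1, ContDiffOn ℝ (⊤ : ℕ∞) (a ε) (Ω ×ˢ (univ : Set (Euc p)))) ∧
  (∀ ε ∈ Set.Ioc (0:ℝ) 1, ∀ K ⊆ Ω, IsCompact K → ∀ (α : List (Fin p)) (β : List (Fin n)),
    ∃ C : ℝ, ∀ y ∈ K, ∀ ξ : Euc p,
      jb ξ ^ (-m + ρ * (α.length : ℝ) - δ * (β.length : ℝ)) *
        ‖dirDs (α.map eXi ++ β.map eY) (a ε) (y, ξ)‖ ≤ C) ∧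
  ∀ K ⊆ Ω, IsCompact K → ∀ (α : List (Fin p)) (β : List (Fin n)), ∀ q : ℕ,
    ∃ C > 0, ∃ η ∈ Set.Ioc (0:ℝ) 1, ∀ ε ∈ Set.Ioc (0:ℝ) η, ∀ y ∈ K, ∀ ξ : Euc p,
      jb ξ ^ (-m + ρ * (α.length : ℝ) - δ * (β.length : ℝ)) *
        ‖dirDs (α.map eXi ++ β.map eY) (a ε) (y, ξ)‖ ≤ C * ε ^ q

/-- Regular net in S^m_{ρ,δ}(Ω×ℝ^p): one N works for all derivatives on each compact set. -/
def SymbRegular {n p : ℕ} (Ω : Set (Euc n)) (m ρ δ : ℝ)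
    (a : ℝ → Euc n × Euc p → ℂ) : Prop :=
  (∀ ε ∈ Set.Ioc (0:ℝ) 1, ContDiffOn ℝ (⊤ : ℕ∞) (a ε) (Ω ×ˢ (univ : Set (Euc p)))) ∧
  (∀ ε ∈ Set.Ioc (0:ℝ) 1, ∀ K ⊆ Ω, IsCompact K → ∀ (α : List (Fin p)) (β : List (Fin n)),
    ∃ C : ℝ, ∀ y ∈ K, ∀ ξ : Euc p,
      jb ξ ^ (-m + ρ * (α.length : ℝ) - δ * (β.length : ℝ)) *
        ‖dirDs (α.map eXi ++ β.map eY) (a ε) (y, ξ)‖ ≤ C) ∧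
  ∀ K ⊆ Ω, IsCompact K → ∃ N : ℕ, ∀ (α : List (Fin p)) (β : List (Fin n)),
    ∃ C > 0, ∃ η ∈ Set.Ioc (0:ℝ) 1, ∀ ε ∈ Set.Ioc (0:ℝ) η, ∀ y ∈ K, ∀ ξ : Euc p,
      jb ξ ^ (-m + ρ * (α.length : ℝ) - δ * (β.length : ℝ)) *
        ‖dirDs (α.map eXi ++ β.map eY) (a ε) (y, ξ)‖ ≤ C * ε ^ (-(N : ℤ))

/-- Moderate net in S^m_hg(Ω×ℝ^p∖0) (F-valued, positively homogeneous symbols). -/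
def HgModerate {n p : ℕ} {F : Type*} [NormedAddCommGroup F] [NormedSpace ℝ F]
    (Ω : Set (Euc n)) (m : ℝ) (φ : ℝ → Euc n × Euc p → F) : Prop :=
  ∀ K ⊆ Ω, IsCompact K → ∀ (α : List (Fin p)) (β : List (Fin n)),
    ∃ N : ℕ, ∃ C > 0, ∃ η ∈ Set.Ioc (0:ℝ) 1, ∀ ε ∈ Set.Ioc (0:ℝ) η, ∀ y ∈ K,
      ∀ ξ : Euc p, ξ ≠ 0 →
      ‖ξ‖ ^ (-m + (α.length : ℝ)) *
        ‖dirDs (α.map eXi ++ β.map eY) (φ ε) (y, ξ)‖ ≤ C * ε ^ (-(N : ℤ))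

/-- Negligible net in S^m_hg(Ω×ℝ^p∖0). -/
def HgNegligible {n p : ℕ} {F : Type*} [NormedAddCommGroup F] [NormedSpace ℝ F]
    (Ω : Set (Euc n)) (m : ℝ) (φ : ℝ → Euc n × Euc p → F) : Prop :=
  ∀ K ⊆ Ω, IsCompact K → ∀ (α : List (Fin p)) (β : List (Fin n)), ∀ q : ℕ,
    ∃ C > 0, ∃ η ∈ Set.Ioc (0:ℝ) 1, ∀ ε ∈ Set.Ioc (0:ℝ) η, ∀ y ∈ K,
      ∀ ξ : Euc p, ξ ≠ 0 →
      ‖ξ‖ ^ (-m + (α.length : ℝ)) *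
        ‖dirDs (α.map eXi ++ β.map eY) (φ ε) (y, ξ)‖ ≤ C * ε ^ q

/-- Net of phase functions on Ω×ℝ^p. -/
def IsPhaseNet {n p : ℕ} (Ω : Set (Euc n)) (φ : ℝ → Euc n × Euc p → ℝ) : Prop :=
  ∀ ε ∈ Set.Ioc (0:ℝ) 1,
    ContDiffOn ℝ (⊤ : ℕ∞) (φ ε) (Ω ×ˢ {ξ : Euc p | ξ ≠ 0}) ∧
    (∀ y ∈ Ω, ∀ ξ : Euc p, ξ ≠ 0 → ∀ t : ℝ, 0 < t → φ ε (y, t • ξ) = t * φ ε (y, ξ)) ∧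
    (∀ y ∈ Ω, ∀ ξ : Euc p, ξ ≠ 0 → gradSq (φ ε) (y, ξ) ≠ 0)

/-- The set M_Φ(Ω×ℝ^p) of moderate nets of phase functions with strictly nonzero gradient. -/
def MPhi {n p : ℕ} (Ω : Set (Euc n)) (φ : ℝ → Euc n × Euc p → ℝ) : Prop :=
  IsPhaseNet Ω φ ∧ HgModerate Ω 1 φ ∧
  ∀ K ⊆ Ω, IsCompact K → ∃ r > (0:ℝ), ∃ η ∈ Set.Ioc (0:ℝ) 1, ∀ ε ∈ Set.Ioc (0:ℝ) η,
    ∀ y ∈ K, ∀ ξ : Euc p, ξ ≠ 0 → ε ^ r ≤ gradSq (φ ε) (y, ‖ξ‖⁻¹ • ξ)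

/-- Slow scale moderateness in S^m_hg. -/
def HgSlowScale {n p : ℕ} {F : Type*} [NormedAddCommGroup F] [NormedSpace ℝ F]
    (Ω : Set (Euc n)) (m : ℝ) (φ : ℝ → Euc n × Euc p → F) : Prop :=
  ∀ K ⊆ Ω, IsCompact K → ∀ (α : List (Fin p)) (β : List (Fin n)),
    ∃ s : ℝ → ℝ, SlowScale s ∧ ∃ η ∈ Set.Ioc (0:ℝ) 1, ∀ ε ∈ Set.Ioc (0:ℝ) η, ∀ y ∈ K,
      ∀ ξ : Euc p, ξ ≠ 0 →
      ‖ξ‖ ^ (-m + (α.length : ℝ)) *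
        ‖dirDs (α.map eXi ++ β.map eY) (φ ε) (y, ξ)‖ ≤ s ε

/-- Slow scale nets of phase functions M_{Φ,sc}(Ω×ℝ^p). -/
def MPhiSc {n p : ℕ} (Ω : Set (Euc n)) (φ : ℝ → Euc n × Euc p → ℝ) : Prop :=
  IsPhaseNet Ω φ ∧ HgSlowScale Ω 1 φ ∧
  ∀ K ⊆ Ω, IsCompact K → ∃ s : ℝ → ℝ, SlowScale s ∧ ∃ η ∈ Set.Ioc (0:ℝ) 1,
    ∀ ε ∈ Set.Ioc (0:ℝ) η, ∀ y ∈ K, ∀ ξ : Euc p, ξ ≠ 0 →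
      (s ε)⁻¹ ≤ gradSq (φ ε) (y, ‖ξ‖⁻¹ • ξ)

/-- cut-off function equal to 1 for |ξ|<1/4 and 0 for |ξ|>1/2. -/
def IsCutoff {p : ℕ} (χ : Euc p → ℝ) : Prop :=
  ContDiff ℝ (⊤ : ℕ∞) χ ∧ (∀ ξ : Euc p, ‖ξ‖ < 1/4 → χ ξ = 1) ∧ (∀ ξ : Euc p, 1/2 < ‖ξ‖ → χ ξ = 0)

/-- 1/|∇_{y,ξ}φ(y,ξ/|ξ|)|². -/
def varphiN {n p : ℕ} (φ : Euc n × Euc p → ℝ) (z : Euc n × Euc p) : ℝ :=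
  (gradSq φ (z.1, ‖z.2‖⁻¹ • z.2))⁻¹

def coefA {n p : ℕ} (χ : Euc p → ℝ) (φ : Euc n × Euc p → ℝ) (j : Fin p) :
    Euc n × Euc p → ℂ :=
  fun z => Complex.I * (((1 - χ z.2) * varphiN φ z * dirD (eXi j) φ z : ℝ) : ℂ)

def coefB {n p : ℕ} (χ : Euc p → ℝ) (φ : Euc n × Euc p → ℝ) (k : Fin n) :
    Euc n × Euc p → ℂ :=
  fun z => Complex.I * (((1 - χ z.2) * (‖z.2‖ ^ 2)⁻¹ * varphiN φ z * dirD (eY k) φ z : ℝ) : ℂ)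

def coefC {n p : ℕ} (χ : Euc p → ℝ) (φ : Euc n × Euc p → ℝ) : Euc n × Euc p → ℂ :=
  fun z => ((χ z.2 : ℝ) : ℂ) + (∑ j : Fin p, dirD (eXi j) (coefA χ φ j) z)
    + ∑ k : Fin n, dirD (eY k) (coefB χ φ k) z

/-- The operator L_φ. -/
def Lop {n p : ℕ} (χ : Euc p → ℝ) (φ : Euc n × Euc p → ℝ) (f : Euc n × Euc p → ℂ) :
    Euc n × Euc p → ℂ :=
  fun z => (∑ j : Fin p, coefA χ φ j z * dirD (eXi j) f z)
    + (∑ k : Fin n, coefB χ φ k z * dirD (eY k) f z) + coefC χ φ z * f z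

/-- Moderate nets of smooth functions E_M(Ω). -/
def EMod {d : ℕ} (Ω : Set (Euc d)) (v : ℝ → Euc d → ℂ) : Prop :=
  (∀ ε ∈ Set.Ioc (0:ℝ) 1, ContDiffOn ℝ (⊤ : ℕ∞) (v ε) Ω) ∧
  ∀ K ⊆ Ω, IsCompact K → ∀ L : List (Fin d),
    ∃ N : ℕ, ∃ C > 0, ∃ η ∈ Set.Ioc (0:ℝ) 1, ∀ ε ∈ Set.Ioc (0:ℝ) η, ∀ x ∈ K,
      ‖dirDs (basisL L) (v ε) x‖ ≤ C * ε ^ (-(N : ℤ))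

/-- Regular nets of smooth functions E^∞_M(Ω). -/
def EModInf {d : ℕ} (Ω : Set (Euc d)) (v : ℝ → Euc d → ℂ) : Prop :=
  (∀ ε ∈ Set.Ioc (0:ℝ) 1, ContDiffOn ℝ (⊤ : ℕ∞) (v ε) Ω) ∧
  ∀ K ⊆ Ω, IsCompact K → ∃ N : ℕ, ∀ L : List (Fin d),
    ∃ C > 0, ∃ η ∈ Set.Ioc (0:ℝ) 1, ∀ ε ∈ Set.Ioc (0:ℝ) η, ∀ x ∈ K,
      ‖dirDs (basisL L) (v ε) x‖ ≤ C * ε ^ (-(N : ℤ))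

/-- Moderate net in S^m_{ρ,δ}(Ω'×Ω×ℝ^p). -/
def Symb3Moderate {q n p : ℕ} (Ω' : Set (Euc q)) (Ω : Set (Euc n)) (m ρ δ : ℝ)
    (a : ℝ → Euc q × Euc n × Euc p → ℂ) : Prop :=
  (∀ ε ∈ Set.Ioc (0:ℝ) 1, ContDiffOn ℝ (⊤ : ℕ∞) (a ε) (Ω' ×ˢ Ω ×ˢ (univ : Set (Euc p)))) ∧
  (∀ ε ∈ Set.Ioc (0:ℝ) 1, ∀ K' ⊆ Ω', IsCompact K' → ∀ K ⊆ Ω, IsCompact K →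
    ∀ (α : List (Fin p)) (βx : List (Fin q)) (βy : List (Fin n)),
    ∃ C : ℝ, ∀ x ∈ K', ∀ y ∈ K, ∀ ξ : Euc p,
      jb ξ ^ (-m + ρ * (α.length : ℝ) - δ * ((βx.length + βy.length : ℕ) : ℝ)) *
        ‖dirDs (α.map eXi3 ++ βx.map eX3 ++ βy.map eY3) (a ε) (x, y, ξ)‖ ≤ C) ∧
  ∀ K' ⊆ Ω', IsCompact K' → ∀ K ⊆ Ω, IsCompact K →
    ∀ (α : List (Fin p)) (βx : List (Fin q)) (βy : List (Fin n)),
    ∃ N : ℕ, ∃ C > 0, ∃ η ∈ Set.Ioc (0:ℝ) 1, ∀ ε ∈ Set.Ioc (0:ℝ) η,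
      ∀ x ∈ K', ∀ y ∈ K, ∀ ξ : Euc p,
      jb ξ ^ (-m + ρ * (α.length : ℝ) - δ * ((βx.length + βy.length : ℕ) : ℝ)) *
        ‖dirDs (α.map eXi3 ++ βx.map eX3 ++ βy.map eY3) (a ε) (x, y, ξ)‖ ≤ C * ε ^ (-(N : ℤ))

/-- Regular net in S^m_{ρ,δ}(Ω'×Ω×ℝ^p). -/
def Symb3Regular {q n p : ℕ} (Ω' : Set (Euc q)) (Ω : Set (Euc n)) (m ρ δ : ℝ)
    (a : ℝ → Euc q × Euc n × Euc p → ℂ) : Prop :=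
  (∀ ε ∈ Set.Ioc (0:ℝ) 1, ContDiffOn ℝ (⊤ : ℕ∞) (a ε) (Ω' ×ˢ Ω ×ˢ (univ : Set (Euc p)))) ∧
  (∀ ε ∈ Set.Ioc (0:ℝ) 1, ∀ K' ⊆ Ω', IsCompact K' → ∀ K ⊆ Ω, IsCompact K →
    ∀ (α : List (Fin p)) (βx : List (Fin q)) (βy : List (Fin n)),
    ∃ C : ℝ, ∀ x ∈ K', ∀ y ∈ K, ∀ ξ : Euc p,
      jb ξ ^ (-m + ρ * (α.length : ℝ) - δ * ((βx.length + βy.length : ℕ) : ℝ)) *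
        ‖dirDs (α.map eXi3 ++ βx.map eX3 ++ βy.map eY3) (a ε) (x, y, ξ)‖ ≤ C) ∧
  ∀ K' ⊆ Ω', IsCompact K' → ∀ K ⊆ Ω, IsCompact K → ∃ N : ℕ,
    ∀ (α : List (Fin p)) (βx : List (Fin q)) (βy : List (Fin n)),
    ∃ C > 0, ∃ η ∈ Set.Ioc (0:ℝ) 1, ∀ ε ∈ Set.Ioc (0:ℝ) η,
      ∀ x ∈ K', ∀ y ∈ K, ∀ ξ : Euc p,
      jb ξ ^ (-m + ρ * (α.length : ℝ) - δ * ((βx.length + βy.length : ℕ) : ℝ)) *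
        ‖dirDs (α.map eXi3 ++ βx.map eX3 ++ βy.map eY3) (a ε) (x, y, ξ)‖ ≤ C * ε ^ (-(N : ℤ))

/-- Moderate net of order −∞ on Ω'×Ω×ℝ^p. -/
def Smoothing3Moderate {q n p : ℕ} (Ω' : Set (Euc q)) (Ω : Set (Euc n))
    (a : ℝ → Euc q × Euc n × Euc p → ℂ) : Prop :=
  (∀ ε ∈ Set.Ioc (0:ℝ) 1, ContDiffOn ℝ (⊤ : ℕ∞) (a ε) (Ω' ×ˢ Ω ×ˢ (univ : Set (Euc p)))) ∧
  (∀ ε ∈ Set.Ioc (0:ℝ) 1, ∀ m : ℝ, ∀ K' ⊆ Ω', IsCompact K' → ∀ K ⊆ Ω, IsCompact K →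
    ∀ (α : List (Fin p)) (βx : List (Fin q)) (βy : List (Fin n)),
    ∃ C : ℝ, ∀ x ∈ K', ∀ y ∈ K, ∀ ξ : Euc p,
      jb ξ ^ (-m + (α.length : ℝ)) *
        ‖dirDs (α.map eXi3 ++ βx.map eX3 ++ βy.map eY3) (a ε) (x, y, ξ)‖ ≤ C) ∧
  ∀ m : ℝ, ∀ K' ⊆ Ω', IsCompact K' → ∀ K ⊆ Ω, IsCompact K →
    ∀ (α : List (Fin p)) (βx : List (Fin q)) (βy : List (Fin n)),
    ∃ N : ℕ, ∃ C > 0, ∃ η ∈ Set.Ioc (0:ℝ) 1, ∀ ε ∈ Set.Ioc (0:ℝ) η,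
      ∀ x ∈ K', ∀ y ∈ K, ∀ ξ : Euc p,
      jb ξ ^ (-m + (α.length : ℝ)) *
        ‖dirDs (α.map eXi3 ++ βx.map eX3 ++ βy.map eY3) (a ε) (x, y, ξ)‖ ≤ C * ε ^ (-(N : ℤ))

/-- Regular net of order −∞ on Ω'×Ω×ℝ^p. -/
def Smoothing3Regular {q n p : ℕ} (Ω' : Set (Euc q)) (Ω : Set (Euc n))
    (a : ℝ → Euc q × Euc n × Euc p → ℂ) : Prop :=
  (∀ ε ∈ Set.Ioc (0:ℝ) 1, ContDiffOn ℝ (⊤ : ℕ∞) (a ε) (Ω' ×ˢ Ω ×ˢ (univ : Set (Euc p)))) ∧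
  (∀ ε ∈ Set.Ioc (0:ℝ) 1, ∀ m : ℝ, ∀ K' ⊆ Ω', IsCompact K' → ∀ K ⊆ Ω, IsCompact K →
    ∀ (α : List (Fin p)) (βx : List (Fin q)) (βy : List (Fin n)),
    ∃ C : ℝ, ∀ x ∈ K', ∀ y ∈ K, ∀ ξ : Euc p,
      jb ξ ^ (-m + (α.length : ℝ)) *
        ‖dirDs (α.map eXi3 ++ βx.map eX3 ++ βy.map eY3) (a ε) (x, y, ξ)‖ ≤ C) ∧
  ∀ K' ⊆ Ω', IsCompact K' → ∀ K ⊆ Ω, IsCompact K → ∃ N : ℕ, ∀ m : ℝ,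
    ∀ (α : List (Fin p)) (βx : List (Fin q)) (βy : List (Fin n)),
    ∃ C > 0, ∃ η ∈ Set.Ioc (0:ℝ) 1, ∀ ε ∈ Set.Ioc (0:ℝ) η,
      ∀ x ∈ K', ∀ y ∈ K, ∀ ξ : Euc p,
      jb ξ ^ (-m + (α.length : ℝ)) *
        ‖dirDs (α.map eXi3 ++ βx.map eX3 ++ βy.map eY3) (a ε) (x, y, ξ)‖ ≤ C * ε ^ (-(N : ℤ))

/-- Nets of phase functions with parameter x ∈ Ω'. -/
def IsPhaseNet3 {q n p : ℕ} (Ω' : Set (Euc q)) (Ω : Set (Euc n))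
    (φ : ℝ → Euc q × Euc n × Euc p → ℝ) : Prop :=
  ∀ ε ∈ Set.Ioc (0:ℝ) 1,
    ContinuousOn (φ ε) (Ω' ×ˢ Ω ×ˢ (univ : Set (Euc p))) ∧
    ContDiffOn ℝ (⊤ : ℕ∞) (φ ε) (Ω' ×ˢ Ω ×ˢ {ξ : Euc p | ξ ≠ 0}) ∧
    (∀ x ∈ Ω', ∀ y ∈ Ω, ∀ ξ : Euc p, ξ ≠ 0 → ∀ t : ℝ, 0 < t →
      φ ε (x, y, t • ξ) = t * φ ε (x, y, ξ)) ∧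
    (∀ x ∈ Ω', ∀ y ∈ Ω, ∀ ξ : Euc p, ξ ≠ 0 → gradSq3 (φ ε) (x, y, ξ) ≠ 0)

/-- S^1_hg-moderateness in all variables for parametrized phase nets. -/
def Hg3Moderate {q n p : ℕ} (Ω' : Set (Euc q)) (Ω : Set (Euc n)) (m : ℝ)
    (φ : ℝ → Euc q × Euc n × Euc p → ℝ) : Prop :=
  ∀ K' ⊆ Ω', IsCompact K' → ∀ K ⊆ Ω, IsCompact K →
    ∀ (α : List (Fin p)) (βx : List (Fin q)) (βy : List (Fin n)),
    ∃ N : ℕ, ∃ C > 0, ∃ η ∈ Set.Ioc (0:ℝ) 1, ∀ ε ∈ Set.Ioc (0:ℝ) η,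
      ∀ x ∈ K', ∀ y ∈ K, ∀ ξ : Euc p, ξ ≠ 0 →
      ‖ξ‖ ^ (-m + (α.length : ℝ)) *
        ‖dirDs (α.map eXi3 ++ βx.map eX3 ++ βy.map eY3) (φ ε) (x, y, ξ)‖ ≤ C * ε ^ (-(N : ℤ))

def Hg3SlowScale {q n p : ℕ} (Ω' : Set (Euc q)) (Ω : Set (Euc n)) (m : ℝ)
    (φ : ℝ → Euc q × Euc n × Euc p → ℝ) : Prop :=
  ∀ K' ⊆ Ω', IsCompact K' → ∀ K ⊆ Ω, IsCompact K →
    ∀ (α : List (Fin p)) (βx : List (Fin q)) (βy : List (Fin n)),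
    ∃ s : ℝ → ℝ, SlowScale s ∧ ∃ η ∈ Set.Ioc (0:ℝ) 1, ∀ ε ∈ Set.Ioc (0:ℝ) η,
      ∀ x ∈ K', ∀ y ∈ K, ∀ ξ : Euc p, ξ ≠ 0 →
      ‖ξ‖ ^ (-m + (α.length : ℝ)) *
        ‖dirDs (α.map eXi3 ++ βx.map eX3 ++ βy.map eY3) (φ ε) (x, y, ξ)‖ ≤ s ε

/-- M_Φ(Ω';Ω×ℝ^p). -/
def MPhi3 {q n p : ℕ} (Ω' : Set (Euc q)) (Ω : Set (Euc n))
    (φ : ℝ → Euc q × Euc n × Euc p → ℝ) : Prop :=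
  IsPhaseNet3 Ω' Ω φ ∧ Hg3Moderate Ω' Ω 1 φ ∧
  ∀ K' ⊆ Ω', IsCompact K' → ∀ K ⊆ Ω, IsCompact K →
    ∃ r > (0:ℝ), ∃ η ∈ Set.Ioc (0:ℝ) 1, ∀ ε ∈ Set.Ioc (0:ℝ) η,
      ∀ x ∈ K', ∀ y ∈ K, ∀ ξ : Euc p, ξ ≠ 0 →
        ε ^ r ≤ gradSq3 (φ ε) (x, y, ‖ξ‖⁻¹ • ξ)

/-- M_{Φ,sc}(Ω';Ω×ℝ^p). -/
def MPhi3Sc {q n p : ℕ} (Ω' : Set (Euc q)) (Ω : Set (Euc n))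
    (φ : ℝ → Euc q × Euc n × Euc p → ℝ) : Prop :=
  IsPhaseNet3 Ω' Ω φ ∧ Hg3SlowScale Ω' Ω 1 φ ∧
  ∀ K' ⊆ Ω', IsCompact K' → ∀ K ⊆ Ω, IsCompact K →
    ∃ s : ℝ → ℝ, SlowScale s ∧ ∃ η ∈ Set.Ioc (0:ℝ) 1, ∀ ε ∈ Set.Ioc (0:ℝ) η,
      ∀ x ∈ K', ∀ y ∈ K, ∀ ξ : Euc p, ξ ≠ 0 →
        (s ε)⁻¹ ≤ gradSq3 (φ ε) (x, y, ‖ξ‖⁻¹ • ξ)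

def varphiN3 {q n p : ℕ} (φ : Euc q × Euc n × Euc p → ℝ) (z : Euc q × Euc n × Euc p) : ℝ :=
  (gradSq3 φ (z.1, z.2.1, ‖z.2.2‖⁻¹ • z.2.2))⁻¹

def coefA3 {q n p : ℕ} (χ : Euc p → ℝ) (φ : Euc q × Euc n × Euc p → ℝ) (j : Fin p) :
    Euc q × Euc n × Euc p → ℂ :=
  fun z => Complex.I * (((1 - χ z.2.2) * varphiN3 φ z * dirD (eXi3 j) φ z : ℝ) : ℂ)

def coefB3 {q n p : ℕ} (χ : Euc p → ℝ) (φ : Euc q × Euc n × Euc p → ℝ) (k : Fin n) :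
    Euc q × Euc n × Euc p → ℂ :=
  fun z => Complex.I * (((1 - χ z.2.2) * (‖z.2.2‖ ^ 2)⁻¹ * varphiN3 φ z * dirD (eY3 k) φ z : ℝ) : ℂ)

def coefC3 {q n p : ℕ} (χ : Euc p → ℝ) (φ : Euc q × Euc n × Euc p → ℝ) :
    Euc q × Euc n × Euc p → ℂ :=
  fun z => ((χ z.2.2 : ℝ) : ℂ) + (∑ j : Fin p, dirD (eXi3 j) (coefA3 χ φ j) z)
    + ∑ k : Fin n, dirD (eY3 k) (coefB3 χ φ k) z

/-- The operator L_φ(x;y,ξ,∂_y,∂_ξ). -/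
def Lop3 {q n p : ℕ} (χ : Euc p → ℝ) (φ : Euc q × Euc n × Euc p → ℝ)
    (f : Euc q × Euc n × Euc p → ℂ) : Euc q × Euc n × Euc p → ℂ :=
  fun z => (∑ j : Fin p, coefA3 χ φ j z * dirD (eXi3 j) f z)
    + (∑ k : Fin n, coefB3 χ φ k z * dirD (eY3 k) f z) + coefC3 χ φ z * f z


/-- Moderate net of order −∞ on Ω×ℝ^p. -/
def SmoothingModerate {n p : ℕ} (Ω : Set (Euc n)) (a : ℝ → Euc n × Euc p → ℂ) : Prop :=
  (∀ ε ∈ Set.Ioc (0:ℝ) 1, ContDiffOn ℝ (⊤ : ℕ∞) (a ε) (Ω ×ˢ (univ : Set (Euc p)))) ∧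
  (∀ ε ∈ Set.Ioc (0:ℝ) 1, ∀ m : ℝ, ∀ K ⊆ Ω, IsCompact K →
    ∀ (α : List (Fin p)) (β : List (Fin n)),
    ∃ C : ℝ, ∀ y ∈ K, ∀ ξ : Euc p,
      jb ξ ^ (-m + (α.length : ℝ)) *
        ‖dirDs (α.map eXi ++ β.map eY) (a ε) (y, ξ)‖ ≤ C) ∧
  ∀ m : ℝ, ∀ K ⊆ Ω, IsCompact K → ∀ (α : List (Fin p)) (β : List (Fin n)),
    ∃ N : ℕ, ∃ C > 0, ∃ η ∈ Set.Ioc (0:ℝ) 1, ∀ ε ∈ Set.Ioc (0:ℝ) η, ∀ y ∈ K, ∀ ξ : Euc p,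
      jb ξ ^ (-m + (α.length : ℝ)) *
        ‖dirDs (α.map eXi ++ β.map eY) (a ε) (y, ξ)‖ ≤ C * ε ^ (-(N : ℤ))

/-- Regular net of order −∞ on Ω×ℝ^p. -/
def SmoothingRegular {n p : ℕ} (Ω : Set (Euc n)) (a : ℝ → Euc n × Euc p → ℂ) : Prop :=
  (∀ ε ∈ Set.Ioc (0:ℝ) 1, ContDiffOn ℝ (⊤ : ℕ∞) (a ε) (Ω ×ˢ (univ : Set (Euc p)))) ∧
  (∀ ε ∈ Set.Ioc (0:ℝ) 1, ∀ m : ℝ, ∀ K ⊆ Ω, IsCompact K →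
    ∀ (α : List (Fin p)) (β : List (Fin n)),
    ∃ C : ℝ, ∀ y ∈ K, ∀ ξ : Euc p,
      jb ξ ^ (-m + (α.length : ℝ)) *
        ‖dirDs (α.map eXi ++ β.map eY) (a ε) (y, ξ)‖ ≤ C) ∧
  ∀ K ⊆ Ω, IsCompact K → ∃ N : ℕ, ∀ m : ℝ, ∀ (α : List (Fin p)) (β : List (Fin n)),
    ∃ C > 0, ∃ η ∈ Set.Ioc (0:ℝ) 1, ∀ ε ∈ Set.Ioc (0:ℝ) η, ∀ y ∈ K, ∀ ξ : Euc p,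
      jb ξ ^ (-m + (α.length : ℝ)) *
        ‖dirDs (α.map eXi ++ β.map eY) (a ε) (y, ξ)‖ ≤ C * ε ^ (-(N : ℤ))

/-- Moderate net in S^m_{ρ,δ}(V) on the conic set V = Ω×(ℝ^p∖0). -/
def ConicModerate {n p : ℕ} (Ω : Set (Euc n)) (m ρ δ : ℝ)
    (a : ℝ → Euc n × Euc p → ℂ) : Prop :=
  (∀ ε ∈ Set.Ioc (0:ℝ) 1, ContDiffOn ℝ (⊤ : ℕ∞) (a ε) (Ω ×ˢ {ξ : Euc p | ξ ≠ 0})) ∧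
  (∀ ε ∈ Set.Ioc (0:ℝ) 1, ∀ K ⊆ Ω ×ˢ {ξ : Euc p | ξ ≠ 0}, IsCompact K →
    ∀ (α : List (Fin p)) (β : List (Fin n)), ∃ C : ℝ, ∀ z ∈ K, ∀ t : ℝ, 1 ≤ t →
      jb (t • z.2) ^ (-m + ρ * (α.length : ℝ) - δ * (β.length : ℝ)) *
        ‖dirDs (α.map eXi ++ β.map eY) (a ε) (z.1, t • z.2)‖ ≤ C) ∧
  ∀ K ⊆ Ω ×ˢ {ξ : Euc p | ξ ≠ 0}, IsCompact K →
    ∀ (α : List (Fin p)) (β : List (Fin n)),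
    ∃ N : ℕ, ∃ C > 0, ∃ η ∈ Set.Ioc (0:ℝ) 1, ∀ ε ∈ Set.Ioc (0:ℝ) η, ∀ z ∈ K, ∀ t : ℝ, 1 ≤ t →
      jb (t • z.2) ^ (-m + ρ * (α.length : ℝ) - δ * (β.length : ℝ)) *
        ‖dirDs (α.map eXi ++ β.map eY) (a ε) (z.1, t • z.2)‖ ≤ C * ε ^ (-(N : ℤ))

/-- Negligible net in S^m_{ρ,δ}(V) on the conic set V = Ω×(ℝ^p∖0). -/
def ConicNegligible {n p : ℕ} (Ω : Set (Euc n)) (m ρ δ : ℝ)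
    (a : ℝ → Euc n × Euc p → ℂ) : Prop :=
  (∀ ε ∈ Set.Ioc (0:ℝ) 1, ContDiffOn ℝ (⊤ : ℕ∞) (a ε) (Ω ×ˢ {ξ : Euc p | ξ ≠ 0})) ∧
  (∀ ε ∈ Set.Ioc (0:ℝ) 1, ∀ K ⊆ Ω ×ˢ {ξ : Euc p | ξ ≠ 0}, IsCompact K →
    ∀ (α : List (Fin p)) (β : List (Fin n)), ∃ C : ℝ, ∀ z ∈ K, ∀ t : ℝ, 1 ≤ t →
      jb (t • z.2) ^ (-m + ρ * (α.length : ℝ) - δ * (β.length : ℝ)) *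
        ‖dirDs (α.map eXi ++ β.map eY) (a ε) (z.1, t • z.2)‖ ≤ C) ∧
  ∀ K ⊆ Ω ×ˢ {ξ : Euc p | ξ ≠ 0}, IsCompact K →
    ∀ (α : List (Fin p)) (β : List (Fin n)), ∀ q : ℕ,
    ∃ C > 0, ∃ η ∈ Set.Ioc (0:ℝ) 1, ∀ ε ∈ Set.Ioc (0:ℝ) η, ∀ z ∈ K, ∀ t : ℝ, 1 ≤ t →
      jb (t • z.2) ^ (-m + ρ * (α.length : ℝ) - δ * (β.length : ℝ)) *
        ‖dirDs (α.map eXi ++ β.map eY) (a ε) (z.1, t • z.2)‖ ≤ C * ε ^ q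

/-- A point (x₀,ξ₀) at which |∇_ξφ|² is invertible on a neighborhood U×Γ. -/
def InvPt {n p : ℕ} (Ω : Set (Euc n)) (φ : ℝ → Euc n × Euc p → ℝ)
    (z : Euc n × Euc p) : Prop :=
  ∃ U : Set (Euc n), IsOpen U ∧ z.1 ∈ U ∧ U ⊆ Ω ∧ IsCompact (closure U) ∧
  ∃ Γ : Set (Euc p), IsOpen Γ ∧ z.2 ∈ Γ ∧ (∀ ξ ∈ Γ, ∀ t : ℝ, 0 < t → t • ξ ∈ Γ) ∧
  ∃ r : ℝ, ∃ η ∈ Set.Ioc (0:ℝ) 1, ∀ ε ∈ Set.Ioc (0:ℝ) η, ∀ y ∈ U, ∀ ξ ∈ Γ,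
    ε ^ r ≤ gradXiSq (φ ε) (y, ξ)

/-- A point (x₀,ξ₀) at which |∇_ξφ|² is slow scale-invertible on a neighborhood U×Γ. -/
def InvPtSc {n p : ℕ} (Ω : Set (Euc n)) (φ : ℝ → Euc n × Euc p → ℝ)
    (z : Euc n × Euc p) : Prop :=
  ∃ U : Set (Euc n), IsOpen U ∧ z.1 ∈ U ∧ U ⊆ Ω ∧ IsCompact (closure U) ∧
  ∃ Γ : Set (Euc p), IsOpen Γ ∧ z.2 ∈ Γ ∧ (∀ ξ ∈ Γ, ∀ t : ℝ, 0 < t → t • ξ ∈ Γ) ∧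
  ∃ s : ℝ → ℝ, SlowScale s ∧ ∃ η ∈ Set.Ioc (0:ℝ) 1, ∀ ε ∈ Set.Ioc (0:ℝ) η, ∀ y ∈ U, ∀ ξ ∈ Γ,
    (s ε)⁻¹ ≤ gradXiSq (φ ε) (y, ξ)

/-- The set C_φ. -/
def Cphi {n p : ℕ} (Ω : Set (Euc n)) (φ : ℝ → Euc n × Euc p → ℝ) : Set (Euc n × Euc p) :=
  {z | z.1 ∈ Ω ∧ z.2 ≠ 0 ∧ ¬ InvPt Ω φ z}

/-- The set R_φ = Ω ∖ π_Ω(C_φ). -/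
def Rphi {n p : ℕ} (Ω : Set (Euc n)) (φ : ℝ → Euc n × Euc p → ℝ) : Set (Euc n) :=
  Ω \ (Prod.fst '' Cphi Ω φ)

/-- The set C^sc_φ. -/
def CphiSc {n p : ℕ} (Ω : Set (Euc n)) (φ : ℝ → Euc n × Euc p → ℝ) : Set (Euc n × Euc p) :=
  {z | z.1 ∈ Ω ∧ z.2 ≠ 0 ∧ ¬ InvPtSc Ω φ z}

/-- The set R^sc_φ = Ω ∖ π_Ω(C^sc_φ). -/
def RphiSc {n p : ℕ} (Ω : Set (Euc n)) (φ : ℝ → Euc n × Euc p → ℝ) : Set (Euc n) :=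
  Ω \ (Prod.fst '' CphiSc Ω φ)

/-- 1/|∇_ξφ(y,ξ/|ξ|)|². -/
def varphiXi {n p : ℕ} (φ : Euc n × Euc p → ℝ) (z : Euc n × Euc p) : ℝ :=
  (gradXiSq φ (z.1, ‖z.2‖⁻¹ • z.2))⁻¹

/-- The transposed regularizing operator in the ξ-variables only:
    ᵗL f = −Σ_j a_j ∂_{ξ_j} f + χ f  with a_j = i(1−χ)|∇_ξφ|⁻²∂_{ξ_j}φ. -/
def tLxi {n p : ℕ} (χ : Euc p → ℝ) (φ : Euc n × Euc p → ℝ) (f : Euc n × Euc p → ℂ) :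
    Euc n × Euc p → ℂ :=
  fun z => -(∑ j : Fin p,
      (Complex.I * (((1 - χ z.2) * varphiXi φ z * dirD (eXi j) φ z : ℝ) : ℂ)) *
        dirD (eXi j) f z)
    + ((χ z.2 : ℝ) : ℂ) * f z

/-- d_{j}(y,θ,ξ) = (ξ_j − ∂_{y_j}φ(y,θ))/|ξ−∇_yφ(y,θ)|². -/
def dj {n p : ℕ} (φ : Euc n × Euc p → ℝ) (ξ : Euc n) (j : Fin n)
    (z : Euc n × Euc p) : ℝ :=
  (ξ j - dirD (eY j) φ z) / ‖ξ - gradY φ z‖ ^ 2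

/-- ᵗL_ε f = −Σ_j d_j D_{y_j} f − Σ_j (D_{y_j} d_j) f, with D_{y_j} = −i∂_{y_j}. -/
def tLW {n p : ℕ} (φ : Euc n × Euc p → ℝ) (ξ : Euc n) (f : Euc n × Euc p → ℂ) :
    Euc n × Euc p → ℂ :=
  fun z => -(∑ j : Fin n, ((dj φ ξ j z : ℝ) : ℂ) * (-Complex.I * dirD (eY j) f z))
    - ∑ j : Fin n, (-Complex.I * ((dirD (eY j) (dj φ ξ j) z : ℝ) : ℂ)) * f z

section DirectionalDerivatives

variable {E F G : Type*} [NormedAddCommGroup E] [NormedSpace ℝ E]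
  [NormedAddCommGroup F] [NormedSpace ℝ F] [NormedAddCommGroup G] [NormedSpace ℝ G]
  {U : Set E} {f g : E → F} {v w : E}

theorem ContDiffOn.differentiableAt_of_isOpen (hf : ContDiffOn ℝ (⊤ : ℕ∞) f U) (hU : IsOpen U)
    {z : E} (hz : z ∈ U) : DifferentiableAt ℝ f z :=
  (hf.contDiffAt (hU.mem_nhds hz)).differentiableAt (by simp)

theorem ContDiffOn.dirD (hf : ContDiffOn ℝ (⊤ : ℕ∞) f U) (hU : IsOpen U) (v : E) :
    ContDiffOn ℝ (⊤ : ℕ∞) (dirD v f) U :=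
  (hf.fderiv_of_isOpen hU (by simp)).clm_apply contDiffOn_const

theorem ContDiffOn.dirDs (hf : ContDiffOn ℝ (⊤ : ℕ∞) f U) (hU : IsOpen U) (L : List E) :
    ContDiffOn ℝ (⊤ : ℕ∞) (dirDs L f) U := by
  induction L with
  | nil => exact hf
  | cons v L ih => exact ih.dirD hU v

theorem Set.EqOn.dirD (h : EqOn f g U) (hU : IsOpen U) (v : E) :
    EqOn (dirD v f) (dirD v g) U := fun z hz => by
  have : f =ᶠ[𝓝 z] g := Filter.eventually_of_mem (hU.mem_nhds hz) h
  simp only [_root_.dirD, this.fderiv_eq]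

theorem dirD_comm (hf : ContDiffOn ℝ (⊤ : ℕ∞) f U) (hU : IsOpen U) (v w : E) :
    EqOn (dirD v (dirD w f)) (dirD w (dirD v f)) U := fun z hz => by
  have hs : IsSymmSndFDerivAt ℝ f z :=
    (hf.contDiffAt (hU.mem_nhds hz)).isSymmSndFDerivAt
      (by simpa using
        (WithTop.coe_le_coe.2 le_top : ((2 : ℕ∞) : WithTop ℕ∞) ≤ ((⊤ : ℕ∞) : WithTop ℕ∞)))
  have hd : DifferentiableAt ℝ (fderiv ℝ f) z :=
    (hf.fderiv_of_isOpen hU (m := (⊤ : ℕ∞)) (by simp)).differentiableAt_of_isOpen hU hz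
  have key : ∀ a b : E, dirD a (dirD b f) z = fderiv ℝ (fderiv ℝ f) z a b := fun a b => by
    unfold dirD
    rw [fderiv_clm_apply hd (differentiableAt_const b)]
    simp
  rw [key, key, hs.eq]

theorem dirDs_perm (hf : ContDiffOn ℝ (⊤ : ℕ∞) f U) (hU : IsOpen U) {L L' : List E}
    (h : L.Perm L') : EqOn (dirDs L f) (dirDs L' f) U := by
  induction h with
  | nil => exact fun _ _ => rfl
  | cons v _ ih => exact ih.dirD hU v
  | swap v w L => exact dirD_comm (hf.dirDs hU L) hU w v
  | trans _ _ ih₁ ih₂ => exact ih₁.trans ih₂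

theorem dirD_add (hf : ContDiffOn ℝ (⊤ : ℕ∞) f U) (hg : ContDiffOn ℝ (⊤ : ℕ∞) g U)
    (hU : IsOpen U) (v : E) :
    EqOn (dirD v fun z => f z + g z) (fun z => dirD v f z + dirD v g z) U := fun z hz => by
  simp only [dirD, fderiv_fun_add (hf.differentiableAt_of_isOpen hU hz)
    (hg.differentiableAt_of_isOpen hU hz), add_apply]

theorem dirD_mul {f g : E → ℝ} (hf : ContDiffOn ℝ (⊤ : ℕ∞) f U)
    (hg : ContDiffOn ℝ (⊤ : ℕ∞) g U) (hU : IsOpen U) (v : E) :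
    EqOn (dirD v fun z => f z * g z) (fun z => dirD v f z * g z + f z * dirD v g z) U :=
  fun z hz => by
  simp only [dirD, fderiv_fun_mul (hf.differentiableAt_of_isOpen hU hz)
    (hg.differentiableAt_of_isOpen hU hz), add_apply,
    smul_apply, smul_eq_mul]
  ring

theorem dirD_inv {f : E → ℝ} (hf : ContDiffOn ℝ (⊤ : ℕ∞) f U) (h0 : ∀ z ∈ U, f z ≠ 0)
    (hU : IsOpen U) (v : E) :
    EqOn (dirD v fun z => (f z)⁻¹) (fun z => -dirD v f z * ((f z)⁻¹ * (f z)⁻¹)) U :=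
  fun z hz => by
  have h := ((hasFDerivAt_inv (h0 z hz)).comp z
    (hf.differentiableAt_of_isOpen hU hz).hasFDerivAt).fderiv
  simp only [Function.comp_def] at h
  simp only [dirD, h, ContinuousLinearMap.comp_apply,
    ContinuousLinearMap.toSpanSingleton_apply, smul_eq_mul, pow_two, mul_inv]
  ring

theorem dirD_clm_comp (T : F →L[ℝ] G) (hf : ContDiffOn ℝ (⊤ : ℕ∞) f U) (hU : IsOpen U)
    (v : E) : EqOn (dirD v fun z => T (f z)) (fun z => T (dirD v f z)) U := fun z hz => by
  have h := (T.hasFDerivAt.comp z (hf.differentiableAt_of_isOpen hU hz).hasFDerivAt).fderiv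
  simp only [Function.comp_def] at h
  simp [dirD, h]

end DirectionalDerivatives

section SymbolCalculus

/-- The coordinate direction in `ξ` (left) or `y` (right). -/
def dirVec {n p : ℕ} : Fin p ⊕ Fin n → Euc n × Euc p := Sum.elim eXi eY

/-- The order lost by a derivative in the direction `dirVec d`. -/
def dirOrd {n p : ℕ} : Fin p ⊕ Fin n → ℝ := Sum.elim (fun _ => 1) (fun _ => 0)

variable {n p : ℕ} {F G : Type*} [NormedAddCommGroup F] [NormedSpace ℝ F]
  [NormedAddCommGroup G] [NormedSpace ℝ G]

/-- A bound of the net `f` on `K × V`, for all compact `K ⊆ Ω`, by `w ^ m` times a power of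
`ε⁻¹`, eventually along the filter `l`. -/
def SymbolBound (l : Filter ℝ) (Ω : Set (Euc n)) (V : Set (Euc p)) (w : Euc p → ℝ) (m : ℝ)
    (f : ℝ → Euc n × Euc p → F) : Prop :=
  ∀ K ⊆ Ω, IsCompact K → ∃ N : ℕ, ∃ C > 0, ∀ᶠ ε in l, ∀ y ∈ K, ∀ ξ ∈ V,
    ‖f ε (y, ξ)‖ ≤ C * ε⁻¹ ^ N * w ξ ^ m

/-- Nets of symbols of order `m` on `Ω × V` with weight `w`, with bounds on the derivatives up to
order `k`. -/
def IsSymbol (l : Filter ℝ) (Ω : Set (Euc n)) (V : Set (Euc p)) (w : Euc p → ℝ) :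
    ℕ → ℝ → (ℝ → Euc n × Euc p → F) → Prop
  | 0, m, f => (∀ ε ∈ Set.Ioc (0:ℝ) 1, ContDiffOn ℝ (⊤ : ℕ∞) (f ε) (Ω ×ˢ V)) ∧
      SymbolBound l Ω V w m f
  | k + 1, m, f => ((∀ ε ∈ Set.Ioc (0:ℝ) 1, ContDiffOn ℝ (⊤ : ℕ∞) (f ε) (Ω ×ˢ V)) ∧
      SymbolBound l Ω V w m f) ∧
      ∀ d, IsSymbol l Ω V w k (m - dirOrd d) (fun ε => dirD (dirVec d) (f ε))

/-- The standing assumptions on the data of a symbol class. -/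
structure SymbolDomain (l : Filter ℝ) (Ω : Set (Euc n)) (V : Set (Euc p)) (w : Euc p → ℝ) :
    Prop where
  eventually_mem : ∀ᶠ ε in l, ε ∈ Set.Ioc (0:ℝ) 1
  isOpen_left : IsOpen Ω
  isOpen_right : IsOpen V
  weight_pos : ∀ ξ ∈ V, 0 < w ξ

variable {l : Filter ℝ} {Ω : Set (Euc n)} {V : Set (Euc p)} {w : Euc p → ℝ} {k : ℕ} {m m' : ℝ}
  {f g : ℝ → Euc n × Euc p → F}

theorem SymbolDomain.isOpen_prod (hD : SymbolDomain l Ω V w) : IsOpen (Ω ×ˢ V) :=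
  hD.isOpen_left.prod hD.isOpen_right

theorem SymbolBound.congr {F : Type*} [NormedAddCommGroup F]
    {f g : ℝ → Euc n × Euc p → F} (hD : SymbolDomain l Ω V w) (hf : SymbolBound l Ω V w m f)
    (h : ∀ ε ∈ Set.Ioc (0:ℝ) 1, EqOn (g ε) (f ε) (Ω ×ˢ V)) : SymbolBound l Ω V w m g := by
  intro K hK hKc
  obtain ⟨N, C, hC, hb⟩ := hf K hK hKc
  refine ⟨N, C, hC, ?_⟩
  filter_upwards [hb, hD.eventually_mem] with ε hε h01 y hy ξ hξ
  rw [h ε h01 ⟨hK hy, hξ⟩]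
  exact hε y hy ξ hξ

theorem SymbolBound.add {F : Type*} [NormedAddCommGroup F]
    {f g : ℝ → Euc n × Euc p → F} (hD : SymbolDomain l Ω V w) (hf : SymbolBound l Ω V w m f)
    (hg : SymbolBound l Ω V w m g) : SymbolBound l Ω V w m fun ε z => f ε z + g ε z := by
  intro K hK hKc
  obtain ⟨N, C, hC, hb⟩ := hf K hK hKc
  obtain ⟨N', C', hC', hb'⟩ := hg K hK hKc
  refine ⟨N + N', C + C', by positivity, ?_⟩
  filter_upwards [hb, hb', hD.eventually_mem] with ε hε hε' h01 y hy ξ hξ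
  have hw := (Real.rpow_pos_of_pos (hD.weight_pos ξ hξ) m).le
  have h1 : 1 ≤ ε⁻¹ := (one_le_inv₀ h01.1).2 h01.2
  have e1 : ε⁻¹ ^ N ≤ ε⁻¹ ^ (N + N') := pow_le_pow_right₀ h1 (by omega)
  have e2 : ε⁻¹ ^ N' ≤ ε⁻¹ ^ (N + N') := pow_le_pow_right₀ h1 (by omega)
  calc ‖f ε (y, ξ) + g ε (y, ξ)‖ ≤ C * ε⁻¹ ^ N * w ξ ^ m + C' * ε⁻¹ ^ N' * w ξ ^ m :=
        (norm_add_le _ _).trans (add_le_add (hε y hy ξ hξ) (hε' y hy ξ hξ))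
    _ ≤ C * ε⁻¹ ^ (N + N') * w ξ ^ m + C' * ε⁻¹ ^ (N + N') * w ξ ^ m := by gcongr
    _ = _ := by ring

theorem SymbolBound.mul {f g : ℝ → Euc n × Euc p → ℝ} (hD : SymbolDomain l Ω V w)
    (hf : SymbolBound l Ω V w m f) (hg : SymbolBound l Ω V w m' g) :
    SymbolBound l Ω V w (m + m') fun ε z => f ε z * g ε z := by
  intro K hK hKc
  obtain ⟨N, C, hC, hb⟩ := hf K hK hKc
  obtain ⟨N', C', hC', hb'⟩ := hg K hK hKc
  refine ⟨N + N', C * C', by positivity, ?_⟩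
  filter_upwards [hb, hb', hD.eventually_mem] with ε hε hε' h01 y hy ξ hξ
  have hw := hD.weight_pos ξ hξ
  rw [norm_mul]
  refine (mul_le_mul (hε y hy ξ hξ) (hε' y hy ξ hξ) (norm_nonneg _)
    ((norm_nonneg _).trans (hε y hy ξ hξ))).trans_eq ?_
  rw [Real.rpow_add hw]
  ring

theorem SymbolBound.clm_comp (T : F →L[ℝ] G) (hf : SymbolBound l Ω V w m f) :
    SymbolBound l Ω V w m fun ε z => T (f ε z) := by
  intro K hK hKc
  obtain ⟨N, C, hC, hb⟩ := hf K hK hKc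
  refine ⟨N, (‖T‖ + 1) * C, by positivity, ?_⟩
  filter_upwards [hb] with ε hε y hy ξ hξ
  refine (T.le_opNorm _).trans ?_
  rw [mul_assoc (‖T‖ + 1), mul_assoc (‖T‖ + 1)]
  gcongr
  · linarith
  · exact hε y hy ξ hξ

theorem IsSymbol.smooth (hf : IsSymbol l Ω V w k m f) {ε : ℝ} (hε : ε ∈ Set.Ioc (0:ℝ) 1) :
    ContDiffOn ℝ (⊤ : ℕ∞) (f ε) (Ω ×ˢ V) := by
  cases k with
  | zero => exact hf.1 ε hε
  | succ k => exact hf.1.1 ε hε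

theorem IsSymbol.bound (hf : IsSymbol l Ω V w k m f) : SymbolBound l Ω V w m f := by
  cases k with
  | zero => exact hf.2
  | succ k => exact hf.1.2

theorem IsSymbol.of_succ (hf : IsSymbol l Ω V w (k + 1) m f) : IsSymbol l Ω V w k m f := by
  induction k generalizing m f with
  | zero => exact hf.1
  | succ k ih => exact ⟨hf.1, fun d => ih (hf.2 d)⟩

theorem IsSymbol.congr (hD : SymbolDomain l Ω V w) (hf : IsSymbol l Ω V w k m f)
    (h : ∀ ε ∈ Set.Ioc (0:ℝ) 1, EqOn (g ε) (f ε) (Ω ×ˢ V)) : IsSymbol l Ω V w k m g := by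
  have h0 : (∀ ε ∈ Set.Ioc (0:ℝ) 1, ContDiffOn ℝ (⊤ : ℕ∞) (g ε) (Ω ×ˢ V)) ∧
      SymbolBound l Ω V w m g :=
    ⟨fun ε hε => (hf.smooth hε).congr (h ε hε), hf.bound.congr hD h⟩
  induction k generalizing m f g with
  | zero => exact h0
  | succ k ih =>
    have h' : ∀ d : Fin p ⊕ Fin n, ∀ ε ∈ Set.Ioc (0:ℝ) 1,
        EqOn (dirD (dirVec d) (g ε)) (dirD (dirVec d) (f ε)) (Ω ×ˢ V) :=
      fun d ε hε => (h ε hε).dirD hD.isOpen_prod _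
    exact ⟨h0, fun d => ih (hf.2 d) (h' d)
      ⟨fun ε hε => ((hf.2 d).smooth hε).congr (h' d ε hε), (hf.2 d).bound.congr hD (h' d)⟩⟩

theorem IsSymbol.add (hD : SymbolDomain l Ω V w) (hf : IsSymbol l Ω V w k m f)
    (hg : IsSymbol l Ω V w k m g) : IsSymbol l Ω V w k m fun ε z => f ε z + g ε z := by
  have h0 : (∀ ε ∈ Set.Ioc (0:ℝ) 1, ContDiffOn ℝ (⊤ : ℕ∞) (fun z => f ε z + g ε z) (Ω ×ˢ V)) ∧
      SymbolBound l Ω V w m fun ε z => f ε z + g ε z :=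
    ⟨fun ε hε => (hf.smooth hε).add (hg.smooth hε), hf.bound.add hD hg.bound⟩
  induction k generalizing m f g with
  | zero => exact h0
  | succ k ih =>
    refine ⟨h0, fun d => ?_⟩
    refine IsSymbol.congr hD (ih (hf.2 d) (hg.2 d) ?_) fun ε hε =>
      dirD_add (hf.smooth hε) (hg.smooth hε) hD.isOpen_prod _
    exact ⟨fun ε hε => ((hf.2 d).smooth hε).add ((hg.2 d).smooth hε),
      (hf.2 d).bound.add hD (hg.2 d).bound⟩

theorem IsSymbol.clm_comp (hD : SymbolDomain l Ω V w) (T : F →L[ℝ] G)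
    (hf : IsSymbol l Ω V w k m f) : IsSymbol l Ω V w k m fun ε z => T (f ε z) := by
  induction k generalizing m f with
  | zero => exact ⟨fun ε hε => T.contDiff.comp_contDiffOn (hf.smooth hε), hf.bound.clm_comp T⟩
  | succ k ih =>
    refine ⟨⟨fun ε hε => T.contDiff.comp_contDiffOn (hf.smooth hε), hf.bound.clm_comp T⟩,
      fun d => ?_⟩
    exact (ih (hf.2 d)).congr hD fun ε hε => dirD_clm_comp T (hf.smooth hε) hD.isOpen_prod _

theorem IsSymbol.mul {f g : ℝ → Euc n × Euc p → ℝ} (hD : SymbolDomain l Ω V w)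
    (hf : IsSymbol l Ω V w k m f) (hg : IsSymbol l Ω V w k m' g) :
    IsSymbol l Ω V w k (m + m') fun ε z => f ε z * g ε z := by
  induction k generalizing m m' f g with
  | zero => exact ⟨fun ε hε => (hf.smooth hε).mul (hg.smooth hε), hf.bound.mul hD hg.bound⟩
  | succ k ih =>
    refine ⟨⟨fun ε hε => (hf.smooth hε).mul (hg.smooth hε), hf.bound.mul hD hg.bound⟩,
      fun d => ?_⟩
    refine IsSymbol.congr hD ?_ fun ε hε =>
      dirD_mul (hf.smooth hε) (hg.smooth hε) hD.isOpen_prod _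
    have h1 := ih (hf.2 d) hg.of_succ
    have h2 := ih hf.of_succ (hg.2 d)
    rw [show m - dirOrd d + m' = m + m' - dirOrd d by ring] at h1
    rw [show m + (m' - dirOrd d) = m + m' - dirOrd d by ring] at h2
    exact h1.add hD h2

theorem IsSymbol.inv {f : ℝ → Euc n × Euc p → ℝ} (hD : SymbolDomain l Ω V w)
    (hf : IsSymbol l Ω V w k m f)
    (h0 : ∀ ε ∈ Set.Ioc (0:ℝ) 1, ∀ z ∈ Ω ×ˢ V, f ε z ≠ 0)
    (hb : SymbolBound l Ω V w (-m) fun ε z => (f ε z)⁻¹) :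
    IsSymbol l Ω V w k (-m) fun ε z => (f ε z)⁻¹ := by
  induction k with
  | zero => exact ⟨fun ε hε => (hf.smooth hε).inv (h0 ε hε), hb⟩
  | succ k ih =>
    refine ⟨⟨fun ε hε => (hf.smooth hε).inv (h0 ε hε), hb⟩, fun d => ?_⟩
    refine IsSymbol.congr hD ?_ fun ε hε =>
      dirD_inv (hf.smooth hε) (h0 ε hε) hD.isOpen_prod _
    have hi := ih hf.of_succ
    have h := ((hf.2 d).clm_comp hD (-ContinuousLinearMap.id ℝ ℝ)).mul hD (hi.mul hD hi)
    rw [show m - dirOrd d + (-m + -m) = -m - dirOrd d by ring] at h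
    simpa using h

theorem IsSymbol.zero (hD : SymbolDomain l Ω V w) :
    IsSymbol l Ω V w k m fun _ _ => (0 : F) := by
  have h0 : ∀ m : ℝ, (∀ ε ∈ Set.Ioc (0:ℝ) 1,
      ContDiffOn ℝ (⊤ : ℕ∞) (fun _ : Euc n × Euc p => (0 : F)) (Ω ×ˢ V)) ∧
      SymbolBound l Ω V w m fun _ _ => (0 : F) := fun m =>
    ⟨fun _ _ => contDiffOn_const, fun K _ _ => ⟨0, 1, one_pos, .of_forall fun ε y _ ξ hξ => by
      have := (Real.rpow_pos_of_pos (hD.weight_pos ξ hξ) m).le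
      simpa⟩⟩
  induction k generalizing m with
  | zero => exact h0 m
  | succ k ih =>
    refine ⟨h0 m, fun d => IsSymbol.congr hD ih fun ε _ z _ => ?_⟩
    simp [dirD]

theorem IsSymbol.const (hD : SymbolDomain l Ω V w) (c : F) :
    IsSymbol l Ω V w k 0 fun _ _ => c := by
  have h0 : (∀ ε ∈ Set.Ioc (0:ℝ) 1,
      ContDiffOn ℝ (⊤ : ℕ∞) (fun _ : Euc n × Euc p => c) (Ω ×ˢ V)) ∧
      SymbolBound l Ω V w 0 fun _ _ => c :=
    ⟨fun _ _ => contDiffOn_const, fun K _ _ => ⟨0, ‖c‖ + 1, by positivity,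
      .of_forall fun ε y _ ξ hξ => by simp⟩⟩
  cases k with
  | zero => exact h0
  | succ k =>
    refine ⟨h0, fun d => IsSymbol.congr hD (IsSymbol.zero hD) fun ε _ z _ => ?_⟩
    simp [dirD]

theorem IsSymbol.sum {ι : Type*} (hD : SymbolDomain l Ω V w) (s : Finset ι)
    {f : ι → ℝ → Euc n × Euc p → F} (hf : ∀ i ∈ s, IsSymbol l Ω V w k m (f i)) :
    IsSymbol l Ω V w k m fun ε z => ∑ i ∈ s, f i ε z := by
  classical
  induction s using Finset.induction_on with
  | empty => simpa using IsSymbol.zero hD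
  | insert a s ha ih =>
    simp only [Finset.sum_insert ha]
    exact (hf a (s.mem_insert_self a)).add hD
      (ih fun i hi => hf i (Finset.mem_insert_of_mem hi))

end SymbolCalculus

section Transfer

variable {n p : ℕ} {F : Type*} [NormedAddCommGroup F] [NormedSpace ℝ F]
  {l : Filter ℝ} {Ω : Set (Euc n)} {V V' : Set (Euc p)} {w w' : Euc p → ℝ} {k : ℕ} {m : ℝ}
  {f : ℝ → Euc n × Euc p → F}

theorem IsSymbol.change_weight (hD' : SymbolDomain l Ω V' w') (hV : V' ⊆ V)
    (hw : ∀ m : ℝ, ∃ C > 0, ∀ ξ ∈ V', w ξ ^ m ≤ C * w' ξ ^ m)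
    (hf : IsSymbol l Ω V w k m f) : IsSymbol l Ω V' w' k m f := by
  have h0 : ∀ (k : ℕ) (m : ℝ) (f : ℝ → Euc n × Euc p → F), IsSymbol l Ω V w k m f →
      (∀ ε ∈ Set.Ioc (0:ℝ) 1, ContDiffOn ℝ (⊤ : ℕ∞) (f ε) (Ω ×ˢ V')) ∧
      SymbolBound l Ω V' w' m f := by
    intro k m f hf
    refine ⟨fun ε hε => (hf.smooth hε).mono (prod_mono_right hV), fun K hK hKc => ?_⟩
    obtain ⟨N, C, hC, hb⟩ := hf.bound K hK hKc
    obtain ⟨C', hC', hw'⟩ := hw m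
    refine ⟨N, C * C', by positivity, ?_⟩
    filter_upwards [hb, hD'.eventually_mem] with ε hε h01 y hy ξ hξ
    have := inv_pos.2 h01.1
    calc ‖f ε (y, ξ)‖ ≤ C * ε⁻¹ ^ N * w ξ ^ m := hε y hy ξ (hV hξ)
      _ ≤ C * ε⁻¹ ^ N * (C' * w' ξ ^ m) := by gcongr; exact hw' ξ hξ
      _ = _ := by ring
  induction k generalizing m f with
  | zero => exact h0 _ _ _ hf
  | succ k ih => exact ⟨h0 _ _ _ hf, fun d => ih (hf.2 d)⟩

theorem IsSymbol.union (hD : SymbolDomain l Ω V w) (hD' : SymbolDomain l Ω V' w)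
    (hf : IsSymbol l Ω V w k m f) (hf' : IsSymbol l Ω V' w k m f) :
    IsSymbol l Ω (V ∪ V') w k m f := by
  have h0 : ∀ (k : ℕ) (m : ℝ) (f : ℝ → Euc n × Euc p → F), IsSymbol l Ω V w k m f →
      IsSymbol l Ω V' w k m f →
      (∀ ε ∈ Set.Ioc (0:ℝ) 1, ContDiffOn ℝ (⊤ : ℕ∞) (f ε) (Ω ×ˢ (V ∪ V'))) ∧
      SymbolBound l Ω (V ∪ V') w m f := by
    intro k m f hf hf'
    refine ⟨fun ε hε => ?_, fun K hK hKc => ?_⟩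
    · rw [prod_union]
      exact (hf.smooth hε).union_of_isOpen (hf'.smooth hε) hD.isOpen_prod hD'.isOpen_prod
    obtain ⟨N, C, hC, hb⟩ := hf.bound K hK hKc
    obtain ⟨N', C', hC', hb'⟩ := hf'.bound K hK hKc
    refine ⟨N + N', C + C', by positivity, ?_⟩
    filter_upwards [hb, hb', hD.eventually_mem] with ε hε hε' h01 y hy ξ hξ
    have h1 : 1 ≤ ε⁻¹ := (one_le_inv₀ h01.1).2 h01.2
    have e1 : ε⁻¹ ^ N ≤ ε⁻¹ ^ (N + N') := pow_le_pow_right₀ h1 (by omega)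
    have e2 : ε⁻¹ ^ N' ≤ ε⁻¹ ^ (N + N') := pow_le_pow_right₀ h1 (by omega)
    have hw : 0 < w ξ := hξ.elim (hD.weight_pos ξ) (hD'.weight_pos ξ)
    rcases hξ with hξ | hξ
    · refine (hε y hy ξ hξ).trans ?_
      gcongr
      linarith
    · refine (hε' y hy ξ hξ).trans ?_
      gcongr
      linarith
  induction k generalizing m f with
  | zero => exact h0 _ _ _ hf hf'
  | succ k ih => exact ⟨h0 _ _ _ hf hf', fun d => ih (hf.2 d) (hf'.2 d)⟩

theorem IsSymbol.of_isCompact (hD : SymbolDomain l Ω V w) {Q : Set (Euc p)} (hQ : IsCompact Q)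
    (hVQ : V ⊆ Q) (hw : ContinuousOn w Q) (hpos : ∀ ξ ∈ Q, 0 < w ξ)
    {f : Euc n × Euc p → F} (hf : ContDiff ℝ (⊤ : ℕ∞) f) :
    IsSymbol l Ω V w k m fun _ => f := by
  have h0 : ∀ (m : ℝ) (f : Euc n × Euc p → F), ContDiff ℝ (⊤ : ℕ∞) f →
      (∀ ε ∈ Set.Ioc (0:ℝ) 1, ContDiffOn ℝ (⊤ : ℕ∞) f (Ω ×ˢ V)) ∧
      SymbolBound l Ω V w m fun _ => f := by
    intro m f hf
    refine ⟨fun _ _ => hf.contDiffOn, fun K hK hKc => ?_⟩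
    have hc : ContinuousOn (fun z : Euc n × Euc p => w z.2 ^ (-m) • f z) (K ×ˢ Q) :=
      ((hw.comp continuousOn_snd fun z hz => hz.2).rpow_const
        fun z hz => Or.inl (hpos _ hz.2).ne').smul hf.continuous.continuousOn
    obtain ⟨C, hC⟩ := (hKc.prod hQ).exists_bound_of_continuousOn hc
    refine ⟨0, |C| + 1, by positivity, .of_forall fun ε y hy ξ hξ => ?_⟩
    have hwp := hD.weight_pos ξ hξ
    have h := hC (y, ξ) ⟨hy, hVQ hξ⟩
    rw [norm_smul, Real.norm_of_nonneg (Real.rpow_pos_of_pos hwp _).le, Real.rpow_neg hwp.le,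
      inv_mul_le_iff₀ (Real.rpow_pos_of_pos hwp m), mul_comm] at h
    rw [pow_zero, mul_one]
    refine h.trans ?_
    gcongr
    linarith [le_abs_self C]
  induction k generalizing m f with
  | zero => exact h0 m f hf
  | succ k ih =>
    exact ⟨h0 m f hf, fun d => ih ((hf.fderiv_right (by simp)).clm_apply contDiff_const)⟩

theorem IsSymbol.dirDs (L : List (Fin p ⊕ Fin n)) (hf : ∀ k, IsSymbol l Ω V w k m f) (k : ℕ) :
    IsSymbol l Ω V w k (m - (L.map dirOrd).sum) fun ε => dirDs (L.map dirVec) (f ε) := by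
  induction L generalizing k with
  | nil => simpa [_root_.dirDs] using hf k
  | cons d L ih =>
    have h := (ih (k + 1)).2 d
    rw [sub_sub, add_comm] at h
    simpa [_root_.dirDs] using h

theorem isSymbol_of_dirDs (hf : ∀ ε ∈ Set.Ioc (0:ℝ) 1, ContDiffOn ℝ (⊤ : ℕ∞) (f ε) (Ω ×ˢ V))
    (hD : SymbolDomain l Ω V w)
    (hb : ∀ L : List (Fin p ⊕ Fin n), SymbolBound l Ω V w (m - (L.map dirOrd).sum)
      fun ε => dirDs (L.map dirVec) (f ε)) (k : ℕ) : IsSymbol l Ω V w k m f := by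
  have h0 : SymbolBound l Ω V w m f := by simpa [_root_.dirDs] using hb []
  induction k generalizing m f with
  | zero => exact ⟨hf, h0⟩
  | succ k ih =>
    have hb' : ∀ (d : Fin p ⊕ Fin n) (L : List (Fin p ⊕ Fin n)),
        SymbolBound l Ω V w (m - dirOrd d - (L.map dirOrd).sum)
          fun ε => _root_.dirDs (L.map dirVec) (dirD (dirVec d) (f ε)) := by
      intro d L
      have h := hb (L ++ [d])
      simp only [List.map_append, List.map_cons, List.map_nil, List.sum_append, List.sum_cons,
        List.sum_nil, add_zero, _root_.dirDs, List.foldr_append, List.foldr_cons,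
        List.foldr_nil] at h
      rw [show m - dirOrd d - (L.map dirOrd).sum = m - ((L.map dirOrd).sum + dirOrd d) by ring]
      exact h
    exact ⟨⟨hf, h0⟩, fun d => ih (fun ε hε => (hf ε hε).dirD hD.isOpen_prod _) (hb' d)
      (by simpa [_root_.dirDs] using hb' d [])⟩

theorem exists_perm_dirVec (L : List (Fin p ⊕ Fin n)) : ∃ (α : List (Fin p)) (β : List (Fin n)),
    (L.map dirVec).Perm (α.map eXi ++ β.map eY) ∧ (L.map dirOrd).sum = α.length := by
  induction L with
  | nil => exact ⟨[], [], by simp, by simp⟩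
  | cons d L ih =>
    obtain ⟨α, β, h, hs⟩ := ih
    rcases d with j | i
    · refine ⟨j :: α, β, h.cons _, ?_⟩
      rw [List.map_cons, List.sum_cons, hs]
      simp [dirOrd, add_comm]
    · refine ⟨α, i :: β, (h.cons _).trans List.perm_middle.symm, ?_⟩
      rw [List.map_cons, List.sum_cons, hs]
      simp [dirOrd]

end Transfer

section Homogeneous

variable {n p : ℕ} {F : Type*} [NormedAddCommGroup F] [NormedSpace ℝ F]
  {l : Filter ℝ} {Ω : Set (Euc n)} {m : ℝ}

/-- Positive homogeneity of degree `m` in the second variable on `Ω × (ℝ^p ∖ 0)`. -/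
def IsHomogeneousOn (Ω : Set (Euc n)) (m : ℝ) (f : Euc n × Euc p → F) : Prop :=
  ∀ y ∈ Ω, ∀ ξ : Euc p, ξ ≠ 0 → ∀ t : ℝ, 0 < t → f (y, t • ξ) = t ^ m • f (y, ξ)

theorem isOpen_prod_ne_zero (hΩ : IsOpen Ω) : IsOpen (Ω ×ˢ {ξ : Euc p | ξ ≠ 0}) :=
  hΩ.prod isOpen_ne

theorem IsHomogeneousOn.dirD {f : Euc n × Euc p → F} (hh : IsHomogeneousOn Ω m f)
    (hΩ : IsOpen Ω) (hf : ContDiffOn ℝ (⊤ : ℕ∞) f (Ω ×ˢ {ξ : Euc p | ξ ≠ 0}))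
    (d : Fin p ⊕ Fin n) : IsHomogeneousOn Ω (m - dirOrd d) (dirD (dirVec d) f) := by
  intro y hy ξ hξ t ht
  have hU := isOpen_prod_ne_zero (p := p) hΩ
  have hz : (y, ξ) ∈ Ω ×ˢ {ξ : Euc p | ξ ≠ 0} := ⟨hy, hξ⟩
  have hz' : (y, t • ξ) ∈ Ω ×ˢ {ξ : Euc p | ξ ≠ 0} := ⟨hy, smul_ne_zero ht.ne' hξ⟩
  let S : Euc n × Euc p →L[ℝ] Euc n × Euc p :=
    (ContinuousLinearMap.fst ℝ _ _).prod (t • ContinuousLinearMap.snd ℝ _ _)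
  have hS : ∀ z, S z = (z.1, t • z.2) := fun z => rfl
  have hev : (fun z => f (S z)) =ᶠ[𝓝 (y, ξ)] fun z => t ^ m • f z :=
    Filter.eventually_of_mem (hU.mem_nhds hz) fun z hz => hh z.1 hz.1 z.2 hz.2 t ht
  have h1 : fderiv ℝ (fun z => f (S z)) (y, ξ) = (fderiv ℝ f (y, t • ξ)).comp S :=
    (HasFDerivAt.comp (y, ξ) (f := S) (g := f)
      (hf.differentiableAt_of_isOpen hU hz').hasFDerivAt S.hasFDerivAt).fderiv
  have h2 : fderiv ℝ (fun z => t ^ m • f z) (y, ξ) = t ^ m • fderiv ℝ f (y, ξ) :=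
    fderiv_fun_const_smul (hf.differentiableAt_of_isOpen hU hz) _
  have h3 : S (dirVec d) = t ^ dirOrd d • dirVec d := by
    rw [hS]
    rcases d with j | i
    · simp [dirVec, dirOrd, eXi]
    · simp [dirVec, dirOrd, eY]
  have h4 : t ^ dirOrd d • _root_.dirD (dirVec d) f (y, t • ξ)
      = t ^ m • _root_.dirD (dirVec d) f (y, ξ) := by
    have := congrArg (fun T => T (dirVec d)) ((h1.symm.trans hev.fderiv_eq).trans h2)
    simpa [h3, _root_.dirD] using this
  rw [Real.rpow_sub ht, div_eq_inv_mul, mul_smul, ← h4,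
    inv_smul_smul₀ (Real.rpow_pos_of_pos ht _).ne']

theorem SymbolBound.of_homogeneous {f : ℝ → Euc n × Euc p → F} {ε₀ : ℝ}
    (hε : ∀ᶠ ε in l, f ε = f ε₀)
    (hf : ContinuousOn (f ε₀) (Ω ×ˢ {ξ : Euc p | ξ ≠ 0})) (hh : IsHomogeneousOn Ω m (f ε₀)) :
    SymbolBound l Ω {ξ : Euc p | ξ ≠ 0} norm m f := by
  intro K hK hKc
  have hsub : K ×ˢ Metric.sphere (0 : Euc p) 1 ⊆ Ω ×ˢ {ξ : Euc p | ξ ≠ 0} :=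
    prod_mono hK fun ξ hξ => ne_zero_of_mem_unit_sphere (⟨ξ, hξ⟩ : Metric.sphere (0 : Euc p) 1)
  obtain ⟨C, hC⟩ := (hKc.prod (isCompact_sphere (0 : Euc p) 1)).exists_bound_of_continuousOn
    (hf.mono hsub)
  refine ⟨0, |C| + 1, by positivity, hε.mono fun ε hε y hy ξ hξ => ?_⟩
  have hpos : 0 < ‖ξ‖ := norm_pos_iff.2 hξ
  have hunit : ‖ξ‖⁻¹ • ξ ∈ Metric.sphere (0 : Euc p) 1 := by
    simp [norm_smul, hpos.ne']
  have h := hh y (hK hy) (‖ξ‖⁻¹ • ξ) (smul_ne_zero (inv_pos.2 hpos).ne' hξ) ‖ξ‖ hpos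
  rw [smul_inv_smul₀ hpos.ne'] at h
  rw [hε, h, norm_smul, Real.norm_of_nonneg (Real.rpow_pos_of_pos hpos m).le, mul_comm, pow_zero,
    mul_one]
  gcongr
  linarith [hC (y, ‖ξ‖⁻¹ • ξ) ⟨hy, hunit⟩, le_abs_self C]

theorem isSymbol_of_homogeneous (hD : SymbolDomain l Ω {ξ : Euc p | ξ ≠ 0} norm)
    {f : ℝ → Euc n × Euc p → F} {ε₀ : ℝ} (hε₀ : ε₀ ∈ Set.Ioc (0:ℝ) 1)
    (hε : ∀ᶠ ε in l, f ε = f ε₀)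
    (hf : ∀ ε ∈ Set.Ioc (0:ℝ) 1, ContDiffOn ℝ (⊤ : ℕ∞) (f ε) (Ω ×ˢ {ξ : Euc p | ξ ≠ 0}))
    (hh : IsHomogeneousOn Ω m (f ε₀)) (k : ℕ) :
    IsSymbol l Ω {ξ : Euc p | ξ ≠ 0} norm k m f := by
  have h0 := SymbolBound.of_homogeneous hε (hf ε₀ hε₀).continuousOn hh
  induction k generalizing m f with
  | zero => exact ⟨hf, h0⟩
  | succ k ih =>
    have hε' : ∀ d : Fin p ⊕ Fin n, ∀ᶠ ε in l, dirD (dirVec d) (f ε) = dirD (dirVec d) (f ε₀) :=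
      fun d => hε.mono fun ε hε => by rw [hε]
    have hf' : ∀ d : Fin p ⊕ Fin n, ∀ ε ∈ Set.Ioc (0:ℝ) 1,
        ContDiffOn ℝ (⊤ : ℕ∞) (dirD (dirVec d) (f ε)) (Ω ×ˢ {ξ : Euc p | ξ ≠ 0}) :=
      fun d ε hε => (hf ε hε).dirD hD.isOpen_prod _
    have hh' := hh.dirD hD.isOpen_left (hf ε₀ hε₀)
    exact ⟨⟨hf, h0⟩, fun d => ih (hε' d) (hf' d) (hh' d)
      (SymbolBound.of_homogeneous (hε' d) (hf' d ε₀ hε₀).continuousOn (hh' d))⟩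

end Homogeneous

section Weights

variable {p : ℕ}

theorem jb_pos (ξ : Euc p) : 0 < jb ξ := Real.sqrt_pos.2 (by positivity)

theorem continuous_jb : Continuous (jb : Euc p → ℝ) := by
  unfold jb
  fun_prop

theorem norm_le_jb (ξ : Euc p) : ‖ξ‖ ≤ jb ξ := Real.le_sqrt_of_sq_le (by linarith)

theorem jb_le_norm {ξ : Euc p} (hξ : 1 / 8 < ‖ξ‖) : jb ξ ≤ 9 * ‖ξ‖ :=
  (Real.sqrt_le_left (by positivity)).2 (by nlinarith)

theorem exists_norm_rpow_le_jb_rpow (m : ℝ) :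
    ∃ C > 0, ∀ ξ ∈ {ξ : Euc p | 1 / 8 < ‖ξ‖}, ‖ξ‖ ^ m ≤ C * jb ξ ^ m := by
  refine ⟨1 + 9 ^ (-m), by positivity, fun ξ (hξ : 1 / 8 < ‖ξ‖) => ?_⟩
  have hpos : 0 < ‖ξ‖ := by linarith
  have hj : 0 < jb ξ ^ m := Real.rpow_pos_of_pos (jb_pos ξ) m
  have h9 : (0:ℝ) < 9 ^ (-m) := by positivity
  rcases le_total 0 m with hm | hm
  · have := Real.rpow_le_rpow hpos.le (norm_le_jb ξ) hm
    nlinarith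
  · have h := Real.rpow_le_rpow_of_nonpos (jb_pos ξ) (jb_le_norm hξ) hm
    rw [Real.mul_rpow (by norm_num) hpos.le] at h
    have h' : ‖ξ‖ ^ m ≤ 9 ^ (-m) * jb ξ ^ m := by
      rw [Real.rpow_neg (by norm_num), le_inv_mul_iff₀ (by positivity)]
      exact h
    nlinarith

end Weights

section Cutoff

variable {n p : ℕ} {l : Filter ℝ} {Ω : Set (Euc n)} {χ : Euc p → ℝ}

theorem SymbolDomain.jb (hl : ∀ᶠ ε in l, ε ∈ Set.Ioc (0:ℝ) 1) (hΩ : IsOpen Ω) {V : Set (Euc p)}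
    (hV : IsOpen V) : SymbolDomain l Ω V jb := ⟨hl, hΩ, hV, fun ξ _ => jb_pos ξ⟩

theorem isSymbol_cutoff (hl : ∀ᶠ ε in l, ε ∈ Set.Ioc (0:ℝ) 1) (hΩ : IsOpen Ω)
    (hχ : IsCutoff χ) (k : ℕ) (m : ℝ) :
    IsSymbol l Ω univ jb k m fun _ z => χ z.2 := by
  have hD₁ := SymbolDomain.jb hl hΩ (Metric.isOpen_ball (x := (0 : Euc p)) (ε := 1))
  have ho : IsOpen {ξ : Euc p | 1 / 2 < ‖ξ‖} := isOpen_lt continuous_const continuous_norm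
  have hD₂ := SymbolDomain.jb hl hΩ ho
  have h₁ : IsSymbol l Ω (Metric.ball 0 1) jb k m fun _ z => χ z.2 :=
    IsSymbol.of_isCompact hD₁ (isCompact_closedBall 0 1) Metric.ball_subset_closedBall
      continuous_jb.continuousOn (fun ξ _ => jb_pos ξ) (hχ.1.comp contDiff_snd)
  have h₂ : IsSymbol l Ω {ξ : Euc p | 1 / 2 < ‖ξ‖} jb k m fun _ z => χ z.2 :=
    (IsSymbol.zero hD₂).congr hD₂ fun ε _ z hz => hχ.2.2 z.2 hz.2
  have hU : Metric.ball 0 1 ∪ {ξ : Euc p | 1 / 2 < ‖ξ‖} = univ := by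
    refine eq_univ_of_forall fun ξ => ?_
    rcases lt_or_ge ‖ξ‖ 1 with h | h
    · exact Or.inl (by simpa using h)
    · exact Or.inr (show 1 / 2 < ‖ξ‖ by linarith)
  exact hU ▸ h₁.union hD₁ hD₂ h₂

theorem IsSymbol.one_sub_cutoff_mul (hl : ∀ᶠ ε in l, ε ∈ Set.Ioc (0:ℝ) 1) (hΩ : IsOpen Ω)
    (hχ : IsCutoff χ) {k : ℕ} {m : ℝ} {h : ℝ → Euc n × Euc p → ℝ}
    (hh : IsSymbol l Ω {ξ : Euc p | ξ ≠ 0} norm k m h) :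
    IsSymbol l Ω univ jb k m fun ε z => (1 - χ z.2) * h ε z := by
  have ho : IsOpen {ξ : Euc p | 1 / 8 < ‖ξ‖} := isOpen_lt continuous_const continuous_norm
  have hD₁ := SymbolDomain.jb hl hΩ ho
  have hD₂ := SymbolDomain.jb hl hΩ (Metric.isOpen_ball (x := (0 : Euc p)) (ε := 1 / 4))
  have hχ₁ : IsSymbol l Ω {ξ : Euc p | 1 / 8 < ‖ξ‖} jb k 0 fun _ z => χ z.2 :=
    (isSymbol_cutoff hl hΩ hχ k 0).change_weight hD₁ (subset_univ _)
      fun m => ⟨1, one_pos, fun ξ _ => by simp⟩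
  have hχ₂ := (IsSymbol.const (k := k) hD₁ (1 : ℝ)).add hD₁
    (hχ₁.clm_comp hD₁ (-ContinuousLinearMap.id ℝ ℝ))
  have h₁ := hχ₂.mul hD₁ (hh.change_weight hD₁
    (fun ξ (hξ : 1 / 8 < ‖ξ‖) => norm_pos_iff.1 (by linarith)) exists_norm_rpow_le_jb_rpow)
  rw [zero_add] at h₁
  replace h₁ : IsSymbol l Ω {ξ : Euc p | 1 / 8 < ‖ξ‖} jb k m
      fun ε z => (1 - χ z.2) * h ε z :=
    h₁.congr hD₁ fun ε _ z _ => by simp [sub_eq_add_neg]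
  have h₂ : IsSymbol l Ω (Metric.ball 0 (1 / 4)) jb k m fun ε z => (1 - χ z.2) * h ε z :=
    (IsSymbol.zero hD₂).congr hD₂ fun ε _ z hz => by
      simp [hχ.2.1 z.2 (by simpa using hz.2)]
  have hU : {ξ : Euc p | 1 / 8 < ‖ξ‖} ∪ Metric.ball 0 (1 / 4) = univ := by
    refine eq_univ_of_forall fun ξ => ?_
    rcases lt_or_ge ‖ξ‖ (1 / 4) with h | h
    · exact Or.inr (by simpa using h)
    · exact Or.inl (show 1 / 8 < ‖ξ‖ by linarith)
  exact hU ▸ h₁.union hD₁ hD₂ h₂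

end Cutoff

section Coefficients

variable {n p : ℕ} {l : Filter ℝ} {Ω : Set (Euc n)} {χ : Euc p → ℝ}
  {φ : ℝ → Euc n × Euc p → ℝ}

theorem IsPhaseNet.isHomogeneousOn (hφ : IsPhaseNet Ω φ) {ε : ℝ} (hε : ε ∈ Set.Ioc (0:ℝ) 1) :
    IsHomogeneousOn Ω 1 (φ ε) := fun y hy ξ hξ t ht => by
  rw [(hφ ε hε).2.1 y hy ξ hξ t ht, Real.rpow_one, smul_eq_mul]

theorem gradSq_unit_eq (hΩ : IsOpen Ω) (hφ : IsPhaseNet Ω φ) {ε : ℝ}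
    (hε : ε ∈ Set.Ioc (0:ℝ) 1) {z : Euc n × Euc p} (hz : z ∈ Ω ×ˢ {ξ : Euc p | ξ ≠ 0}) :
    gradSq (φ ε) (z.1, ‖z.2‖⁻¹ • z.2) =
      (∑ k : Fin n, (‖z.2‖ ^ 2)⁻¹ * (dirD (eY k) (φ ε) z * dirD (eY k) (φ ε) z)) +
        ∑ j : Fin p, dirD (eXi j) (φ ε) z * dirD (eXi j) (φ ε) z := by
  have hh := (hφ.isHomogeneousOn hε).dirD hΩ (hφ ε hε).1
  have ht : 0 < ‖z.2‖⁻¹ := inv_pos.2 (norm_pos_iff.2 hz.2)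
  have hY : ∀ k : Fin n, dirD (eY k) (φ ε) (z.1, ‖z.2‖⁻¹ • z.2)
      = ‖z.2‖⁻¹ * dirD (eY k) (φ ε) z := fun k => by
    simpa [dirVec, dirOrd] using hh (.inr k) z.1 hz.1 z.2 hz.2 _ ht
  have hX : ∀ j : Fin p, dirD (eXi j) (φ ε) (z.1, ‖z.2‖⁻¹ • z.2)
      = dirD (eXi j) (φ ε) z := fun j => by
    simpa [dirVec, dirOrd] using hh (.inl j) z.1 hz.1 z.2 hz.2 _ ht
  simp only [gradSq, hY, hX]
  congr 1
  · exact Finset.sum_congr rfl fun k _ => by rw [← inv_pow]; ring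
  · exact Finset.sum_congr rfl fun j _ => by ring

theorem gradSq_unit_ne_zero (hφ : IsPhaseNet Ω φ) {ε : ℝ} (hε : ε ∈ Set.Ioc (0:ℝ) 1)
    {z : Euc n × Euc p} (hz : z ∈ Ω ×ˢ {ξ : Euc p | ξ ≠ 0}) :
    gradSq (φ ε) (z.1, ‖z.2‖⁻¹ • z.2) ≠ 0 :=
  (hφ ε hε).2.2 z.1 hz.1 _ (smul_ne_zero (inv_ne_zero (norm_ne_zero_iff.2 hz.2)) hz.2)

theorem isSymbol_norm_sq_inv (hD : SymbolDomain l Ω {ξ : Euc p | ξ ≠ 0} norm) (k : ℕ) :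
    IsSymbol l Ω {ξ : Euc p | ξ ≠ 0} norm k (-2)
      fun _ (z : Euc n × Euc p) => (‖z.2‖ ^ 2)⁻¹ := by
  refine isSymbol_of_homogeneous hD (ε₀ := 1) (by simp) (.of_forall fun _ => rfl)
    (fun ε _ => ?_) ?_ k
  · refine ContDiffOn.inv (((contDiff_norm_sq ℝ).comp contDiff_snd).contDiffOn) fun z hz => ?_
    exact pow_ne_zero 2 (norm_ne_zero_iff.2 hz.2)
  · intro y hy ξ hξ t ht
    simp only [norm_smul, Real.norm_of_nonneg ht.le, mul_pow, mul_inv, smul_eq_mul]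
    rw [Real.rpow_neg ht.le, Real.rpow_two]

theorem isSymbol_gradSq_unit (hD : SymbolDomain l Ω {ξ : Euc p | ξ ≠ 0} norm)
    (hφ : IsPhaseNet Ω φ) (hs : ∀ k, IsSymbol l Ω {ξ : Euc p | ξ ≠ 0} norm k 1 φ) (k : ℕ) :
    IsSymbol l Ω {ξ : Euc p | ξ ≠ 0} norm k 0
      fun ε z => gradSq (φ ε) (z.1, ‖z.2‖⁻¹ • z.2) := by
  refine IsSymbol.congr hD ?_ fun ε hε z hz => gradSq_unit_eq hD.isOpen_left hφ hε hz
  refine (IsSymbol.sum hD _ fun i _ => ?_).add hD (IsSymbol.sum hD _ fun j _ => ?_)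
  · have h : IsSymbol l Ω {ξ : Euc p | ξ ≠ 0} norm k (1 - 0) fun ε => dirD (eY i) (φ ε) :=
      (hs (k + 1)).2 (.inr i)
    have h' := (isSymbol_norm_sq_inv hD k).mul hD (h.mul hD h)
    norm_num at h'
    exact h'
  · have h : IsSymbol l Ω {ξ : Euc p | ξ ≠ 0} norm k (1 - 1) fun ε => dirD (eXi j) (φ ε) :=
      (hs (k + 1)).2 (.inl j)
    have h' := h.mul hD h
    norm_num at h'
    exact h'

theorem isSymbol_varphiN (hD : SymbolDomain l Ω {ξ : Euc p | ξ ≠ 0} norm)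
    (hφ : IsPhaseNet Ω φ) (hs : ∀ k, IsSymbol l Ω {ξ : Euc p | ξ ≠ 0} norm k 1 φ)
    (hb : SymbolBound l Ω {ξ : Euc p | ξ ≠ 0} norm 0 fun ε => varphiN (φ ε)) (k : ℕ) :
    IsSymbol l Ω {ξ : Euc p | ξ ≠ 0} norm k 0 fun ε => varphiN (φ ε) := by
  have h := (isSymbol_gradSq_unit hD hφ hs k).inv hD
    (fun ε hε z hz => gradSq_unit_ne_zero hφ hε hz) (by rw [neg_zero]; exact hb)
  rw [neg_zero] at h
  exact h

theorem isSymbol_coefA (hD : SymbolDomain l Ω {ξ : Euc p | ξ ≠ 0} norm)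
    (hφ : IsPhaseNet Ω φ) (hχ : IsCutoff χ)
    (hs : ∀ k, IsSymbol l Ω {ξ : Euc p | ξ ≠ 0} norm k 1 φ)
    (hb : SymbolBound l Ω {ξ : Euc p | ξ ≠ 0} norm 0 fun ε => varphiN (φ ε))
    (j : Fin p) (k : ℕ) : IsSymbol l Ω univ jb k 0 fun ε => coefA χ (φ ε) j := by
  have hd : IsSymbol l Ω {ξ : Euc p | ξ ≠ 0} norm k (1 - 1) fun ε => dirD (eXi j) (φ ε) :=
    (hs (k + 1)).2 (.inl j)
  have h := (isSymbol_varphiN hD hφ hs hb k).mul hD hd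
  norm_num at h
  have hDj := SymbolDomain.jb hD.eventually_mem hD.isOpen_left (isOpen_univ (X := Euc p))
  refine ((h.one_sub_cutoff_mul hD.eventually_mem hD.isOpen_left hχ).clm_comp hDj
    (ContinuousLinearMap.toSpanSingleton ℝ Complex.I)).congr hDj fun ε _ z _ => ?_
  simp [coefA]
  ring

theorem isSymbol_coefB (hD : SymbolDomain l Ω {ξ : Euc p | ξ ≠ 0} norm)
    (hφ : IsPhaseNet Ω φ) (hχ : IsCutoff χ)
    (hs : ∀ k, IsSymbol l Ω {ξ : Euc p | ξ ≠ 0} norm k 1 φ)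
    (hb : SymbolBound l Ω {ξ : Euc p | ξ ≠ 0} norm 0 fun ε => varphiN (φ ε))
    (i : Fin n) (k : ℕ) : IsSymbol l Ω univ jb k (-1) fun ε => coefB χ (φ ε) i := by
  have hd : IsSymbol l Ω {ξ : Euc p | ξ ≠ 0} norm k (1 - 0) fun ε => dirD (eY i) (φ ε) :=
    (hs (k + 1)).2 (.inr i)
  have h := (isSymbol_norm_sq_inv hD k).mul hD ((isSymbol_varphiN hD hφ hs hb k).mul hD hd)
  norm_num at h
  have hDj := SymbolDomain.jb hD.eventually_mem hD.isOpen_left (isOpen_univ (X := Euc p))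
  refine ((h.one_sub_cutoff_mul hD.eventually_mem hD.isOpen_left hχ).clm_comp hDj
    (ContinuousLinearMap.toSpanSingleton ℝ Complex.I)).congr hDj fun ε _ z _ => ?_
  simp [coefB]
  ring

theorem isSymbol_coefC (hD : SymbolDomain l Ω {ξ : Euc p | ξ ≠ 0} norm)
    (hφ : IsPhaseNet Ω φ) (hχ : IsCutoff χ)
    (hs : ∀ k, IsSymbol l Ω {ξ : Euc p | ξ ≠ 0} norm k 1 φ)
    (hb : SymbolBound l Ω {ξ : Euc p | ξ ≠ 0} norm 0 fun ε => varphiN (φ ε))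
    (k : ℕ) : IsSymbol l Ω univ jb k (-1) fun ε => coefC χ (φ ε) := by
  have hDj := SymbolDomain.jb hD.eventually_mem hD.isOpen_left (isOpen_univ (X := Euc p))
  refine (((isSymbol_cutoff hD.eventually_mem hD.isOpen_left hχ k (-1)).clm_comp hDj
    Complex.ofRealCLM).add hDj (IsSymbol.sum hDj _ fun j _ => ?_)).add hDj
    (IsSymbol.sum hDj _ fun i _ => ?_)
  · have h : IsSymbol l Ω univ jb k (0 - 1) fun ε => dirD (eXi j) (coefA χ (φ ε) j) :=
      (isSymbol_coefA hD hφ hχ hs hb j (k + 1)).2 (.inl j)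
    rwa [zero_sub] at h
  · have h : IsSymbol l Ω univ jb k (-1 - 0) fun ε => dirD (eY i) (coefB χ (φ ε) i) :=
      (isSymbol_coefB hD hφ hχ hs hb i (k + 1)).2 (.inr i)
    rwa [sub_zero] at h

theorem SymbolDomain.norm (hl : ∀ᶠ ε in l, ε ∈ Set.Ioc (0:ℝ) 1) (hΩ : IsOpen Ω) :
    SymbolDomain l Ω {ξ : Euc p | ξ ≠ 0} norm :=
  ⟨hl, hΩ, isOpen_ne, fun _ hξ => norm_pos_iff.2 hξ⟩

theorem IsPhaseNet.isSymbol_pure (hφ : IsPhaseNet Ω φ) (hΩ : IsOpen Ω) {ε₀ : ℝ}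
    (hε₀ : ε₀ ∈ Set.Ioc (0:ℝ) 1) (k : ℕ) :
    IsSymbol (pure ε₀) Ω {ξ : Euc p | ξ ≠ 0} norm k 1 φ :=
  isSymbol_of_homogeneous (SymbolDomain.norm (Filter.eventually_pure.2 hε₀) hΩ) hε₀
    (Filter.eventually_pure.2 rfl) (fun ε hε => (hφ ε hε).1) (hφ.isHomogeneousOn hε₀) k

theorem IsPhaseNet.symbolBound_varphiN_pure (hφ : IsPhaseNet Ω φ) (hΩ : IsOpen Ω) {ε₀ : ℝ}
    (hε₀ : ε₀ ∈ Set.Ioc (0:ℝ) 1) :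
    SymbolBound (pure ε₀) Ω {ξ : Euc p | ξ ≠ 0} norm 0 fun ε => varphiN (φ ε) := by
  have hD := SymbolDomain.norm (p := p) (l := pure ε₀) (Filter.eventually_pure.2 hε₀) hΩ
  refine SymbolBound.of_homogeneous (ε₀ := ε₀) (Filter.eventually_pure.2 rfl) ?_ ?_
  · exact ((isSymbol_gradSq_unit hD hφ (hφ.isSymbol_pure hΩ hε₀) 0).smooth hε₀).continuousOn.inv₀
      fun z hz => gradSq_unit_ne_zero hφ hε₀ hz
  · intro y hy ξ hξ t ht
    have : ‖t • ξ‖⁻¹ • t • ξ = ‖ξ‖⁻¹ • ξ := by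
      rw [norm_smul, Real.norm_of_nonneg ht.le, smul_smul, mul_inv, mul_right_comm,
        inv_mul_cancel₀ ht.ne', one_mul]
    simp [varphiN, this]

theorem eventually_mem_Ioc : ∀ᶠ ε in 𝓝[>] (0:ℝ), ε ∈ Set.Ioc (0:ℝ) 1 :=
  Ioc_mem_nhdsGT one_pos

theorem MPhi.isSymbol (hφ : MPhi Ω φ) (hΩ : IsOpen Ω) (k : ℕ) :
    IsSymbol (𝓝[>] 0) Ω {ξ : Euc p | ξ ≠ 0} norm k 1 φ := by
  have hD := SymbolDomain.norm (p := p) eventually_mem_Ioc hΩ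
  refine isSymbol_of_dirDs (fun ε hε => (hφ.1 ε hε).1) hD (fun L => ?_) k
  obtain ⟨α, β, hperm, hsum⟩ := exists_perm_dirVec L
  refine SymbolBound.congr hD (f := fun ε => dirDs (α.map eXi ++ β.map eY) (φ ε)) ?_
    fun ε hε => dirDs_perm (hφ.1 ε hε).1 hD.isOpen_prod hperm
  intro K hK hKc
  obtain ⟨N, C, hC, η, hη, hb⟩ := hφ.2.1 K hK hKc α β
  refine ⟨N, C, hC, ?_⟩
  filter_upwards [Ioc_mem_nhdsGT hη.1] with ε hε y hy ξ hξ
  have hpos : 0 < ‖ξ‖ := norm_pos_iff.2 hξ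
  have h := hb ε hε y hy ξ hξ
  rw [show (-1 + (α.length : ℝ)) = -(1 - (L.map dirOrd).sum) by rw [hsum]; ring,
    Real.rpow_neg hpos.le, inv_mul_le_iff₀ (Real.rpow_pos_of_pos hpos _), mul_comm, zpow_neg,
    zpow_natCast, ← inv_pow] at h
  exact h

theorem MPhi.symbolBound_varphiN (hφ : MPhi Ω φ) :
    SymbolBound (𝓝[>] 0) Ω {ξ : Euc p | ξ ≠ 0} norm 0 fun ε => varphiN (φ ε) := by
  intro K hK hKc
  obtain ⟨r, hr, η, hη, hb⟩ := hφ.2.2 K hK hKc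
  refine ⟨⌈r⌉₊, 1, one_pos, ?_⟩
  filter_upwards [Ioc_mem_nhdsGT hη.1] with ε hε y hy ξ hξ
  have h := hb ε hε y hy ξ hξ
  have hεr := Real.rpow_pos_of_pos hε.1 r
  have hpow : ε ^ ⌈r⌉₊ ≤ ε ^ r := by
    rw [← Real.rpow_natCast]
    exact Real.rpow_le_rpow_of_exponent_ge hε.1 (hε.2.trans hη.2) (Nat.le_ceil r)
  rw [varphiN, norm_inv, Real.norm_of_nonneg (hεr.le.trans h), Real.rpow_zero, one_mul, mul_one,
    inv_pow]
  exact inv_anti₀ (pow_pos hε.1 _) (hpow.trans h)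

theorem symbModerate_of_isSymbol {m : ℝ} {a : ℝ → Euc n × Euc p → ℂ}
    (hpure : ∀ ε ∈ Set.Ioc (0:ℝ) 1, ∀ k, IsSymbol (pure ε) Ω univ jb k m a)
    (hlim : ∀ k, IsSymbol (𝓝[>] 0) Ω univ jb k m a) : SymbModerate Ω m 1 0 a := by
  have key : ∀ (l : Filter ℝ), (∀ k, IsSymbol l Ω univ jb k m a) → ∀ K ⊆ Ω, IsCompact K →
      ∀ (α : List (Fin p)) (β : List (Fin n)), ∃ N : ℕ, ∃ C > 0, ∀ᶠ ε in l, ∀ y ∈ K,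
      ∀ ξ : Euc p, jb ξ ^ (-m + 1 * (α.length : ℝ) - 0 * (β.length : ℝ)) *
        ‖dirDs (α.map eXi ++ β.map eY) (a ε) (y, ξ)‖ ≤ C * ε ^ (-(N : ℤ)) := by
    intro l hl K hK hKc α β
    obtain ⟨N, C, hC, hb⟩ := (IsSymbol.dirDs (α.map .inl ++ β.map .inr) hl 0).bound K hK hKc
    refine ⟨N, C, hC, hb.mono fun ε hε y hy ξ => ?_⟩
    have h := hε y hy ξ (mem_univ ξ)
    have hvec : (α.map .inl ++ β.map .inr : List (Fin p ⊕ Fin n)).map dirVec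
        = (α.map eXi ++ β.map eY : List (Euc n × Euc p)) := by
      simp [Function.comp_def, dirVec]
    have hord : ((α.map .inl ++ β.map .inr : List (Fin p ⊕ Fin n)).map dirOrd).sum
        = α.length := by
      simp [Function.comp_def, dirOrd]
    rw [hvec, hord] at h
    rw [show -m + 1 * (α.length : ℝ) - 0 * (β.length : ℝ) = -(m - α.length) by ring,
      Real.rpow_neg (jb_pos ξ).le, inv_mul_le_iff₀ (Real.rpow_pos_of_pos (jb_pos ξ) _), mul_comm,
      zpow_neg, zpow_natCast, ← inv_pow]
    exact h
  refine ⟨fun ε hε => (hpure ε hε 0).smooth hε, fun ε hε K hK hKc α β => ?_,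
    fun K hK hKc α β => ?_⟩
  · obtain ⟨N, C, -, h⟩ := key _ (hpure ε hε) K hK hKc α β
    exact ⟨_, Filter.eventually_pure.1 h⟩
  · obtain ⟨N, C, hC, h⟩ := key _ hlim K hK hKc α β
    obtain ⟨u, hu, hsub⟩ := mem_nhdsGT_iff_exists_Ioc_subset.1 h
    exact ⟨N, C, hC, min u 1, ⟨lt_min hu one_pos, min_le_right _ _⟩,
      fun ε hε => hsub ⟨hε.1, hε.2.trans (min_le_left _ _)⟩⟩

end Coefficients

/-- Proposition on the coefficients of L_φ: for a net in M_Φ(Ω×ℝ^p) the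
coefficients a_{j,ε}, b_{k,ε}, c_ε extend smoothly to Ω×ℝ^p and are moderate nets in
S^0(Ω×ℝ^p) and S^{-1}(Ω×ℝ^p) respectively. -/
theorem stmt3 {n p : ℕ} (Ω : Set (Euc n)) (hΩ : IsOpen Ω)
    (φ : ℝ → Euc n × Euc p → ℝ) (hφ : MPhi Ω φ)
    (χ : Euc p → ℝ) (hχ : IsCutoff χ) :
    (∀ j : Fin p, SymbModerate Ω 0 1 0 (fun ε => coefA χ (φ ε) j)) ∧
    (∀ k : Fin n, SymbModerate Ω (-1) 1 0 (fun ε => coefB χ (φ ε) k)) ∧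
    SymbModerate Ω (-1) 1 0 (fun ε => coefC χ (φ ε)) := by
  have hD := SymbolDomain.norm (p := p) eventually_mem_Ioc hΩ
  have hD' : ∀ ε ∈ Set.Ioc (0:ℝ) 1, SymbolDomain (pure ε) Ω {ξ : Euc p | ξ ≠ 0} norm :=
    fun ε hε => SymbolDomain.norm (Filter.eventually_pure.2 hε) hΩ
  have hs := hφ.isSymbol hΩ
  have hb := hφ.symbolBound_varphiN
  have hs' := fun (ε : ℝ) (hε : ε ∈ Set.Ioc (0:ℝ) 1) => hφ.1.isSymbol_pure hΩ hε
  have hb' := fun (ε : ℝ) (hε : ε ∈ Set.Ioc (0:ℝ) 1) => hφ.1.symbolBound_varphiN_pure hΩ hε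
  refine ⟨fun j => ?_, fun i => ?_, ?_⟩
  · exact symbModerate_of_isSymbol
      (fun ε hε => isSymbol_coefA (hD' ε hε) hφ.1 hχ (hs' ε hε) (hb' ε hε) j)
      (isSymbol_coefA hD hφ.1 hχ hs hb j)
  · exact symbModerate_of_isSymbol
      (fun ε hε => isSymbol_coefB (hD' ε hε) hφ.1 hχ (hs' ε hε) (hb' ε hε) i)
      (isSymbol_coefB hD hφ.1 hχ hs hb i)
  · exact symbModerate_of_isSymbol
      (fun ε hε => isSymbol_coefC (hD' ε hε) hφ.1 hχ (hs' ε hε) (hb' ε hε))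
      (isSymbol_coefC hD hφ.1 hχ hs hb)
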